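/- arXiv:1407.2380 — 2 statements merged into one kernel-verified Lean document; each statement's English description precedes it below -/
import Mathlib

section
/- For every dimension d ≥ 1, for Lebesgue-almost every α = (α_1,…,α_d) ∈ [0,1)^d there exists a constant C(α,d) > 0 such that the discrepancy D_N of the Kronecker sequence z_n = ({nα_1},…,{nα_d}) satisfies D_N ≥ C(α,d) · (log N)^d (log log N) / N for infinitely many N. -/
open MeasureTheory Real

/-- The discrepancy of the first `N` points of a sequence `z` in `[0,1)^ι`. -/
noncomputable def disc {ι : Type*} [Fintype ι] (z : ℕ → ι → ℝ) (N : ℕ) : ℝ :=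
  sSup { r : ℝ | ∃ u v : ι → ℝ,
    (∀ i, 0 ≤ u i ∧ u i ≤ v i ∧ v i ≤ 1) ∧
    r = |(Nat.card {n : ℕ // n < N ∧ ∀ i, u i ≤ z n i ∧ z n i < v i} : ℝ) / N
          - ∏ i, (v i - u i)| }

/-- The sum of the binary logarithms of the coordinates of `h`. -/
def dyadicHeight {ι : Type*} [Fintype ι] (h : ι → ℕ) : ℕ := ∑ i, Nat.log 2 (h i)

/-- The critical quality of approximation `‖h · α‖` for an integer vector `h`. -/
noncomputable def approxRate {d : ℕ} (h : Fin d → ℕ) : ℝ :=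
  1 / (2 ^ dyadicHeight h * ((dyadicHeight h : ℝ) + 2) ^ d * log ((dyadicHeight h : ℝ) + 2))

theorem half_lt_log_add_two (k : ℕ) : 1 / 2 < log ((k : ℝ) + 2) := by
  have h1 : log 2 ≤ log ((k : ℝ) + 2) :=
    log_le_log (by norm_num) (by linarith [k.cast_nonneg (α := ℝ)])
  linarith [log_two_gt_d9]

theorem bddAbove_disc_set {ι : Type*} [Fintype ι] (z : ℕ → ι → ℝ) (N : ℕ) :
    BddAbove { r : ℝ | ∃ u v : ι → ℝ,
      (∀ i, 0 ≤ u i ∧ u i ≤ v i ∧ v i ≤ 1) ∧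
      r = |(Nat.card {n : ℕ // n < N ∧ ∀ i, u i ≤ z n i ∧ z n i < v i} : ℝ) / N
            - ∏ i, (v i - u i)| } := by
  refine ⟨1, ?_⟩
  rintro r ⟨u, v, huv, rfl⟩
  have hcard : Nat.card {n : ℕ // n < N ∧ ∀ i, u i ≤ z n i ∧ z n i < v i} ≤ N := by
    have := Nat.card_mono (Finset.range N).finite_toSet
      (s := {n : ℕ | n < N ∧ ∀ i, u i ≤ z n i ∧ z n i < v i}) (fun n hn => by simpa using hn.1)
    exact this.trans (by simp)
  have h1 : (Nat.card {n : ℕ // n < N ∧ ∀ i, u i ≤ z n i ∧ z n i < v i} : ℝ) / N ≤ 1 :=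
    div_le_one_of_le₀ (by exact_mod_cast hcard) (by positivity)
  have h2 : (0 : ℝ) ≤ (Nat.card {n : ℕ // n < N ∧ ∀ i, u i ≤ z n i ∧ z n i < v i} : ℝ) / N := by
    positivity
  have h3 : ∏ i, (v i - u i) ≤ 1 :=
    Finset.prod_le_one (fun i _ => by linarith [(huv i).2.1])
      (fun i _ => by linarith [(huv i).1, (huv i).2.2])
  have h4 : 0 ≤ ∏ i, (v i - u i) := Finset.prod_nonneg fun i _ => by linarith [(huv i).2.1]
  rw [abs_le]
  constructor <;> linarith

/-- If the first `N` points avoid a box, the discrepancy is at least the volume of the box. -/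
theorem prod_le_disc_of_avoid {ι : Type*} [Fintype ι] {z : ℕ → ι → ℝ} {N : ℕ} {u v : ι → ℝ}
    (huv : ∀ i, 0 ≤ u i ∧ u i ≤ v i ∧ v i ≤ 1)
    (hz : ∀ n < N, ¬ ∀ i, u i ≤ z n i ∧ z n i < v i) :
    ∏ i, (v i - u i) ≤ disc z N := by
  refine le_csSup (bddAbove_disc_set z N) ⟨u, v, huv, ?_⟩
  have : IsEmpty {n : ℕ // n < N ∧ ∀ i, u i ≤ z n i ∧ z n i < v i} := ⟨fun n => hz n n.2.1 n.2.2⟩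
  rw [Nat.card_of_isEmpty, Nat.cast_zero, zero_div, zero_sub, abs_neg, abs_of_nonneg]
  exact Finset.prod_nonneg fun i _ => by linarith [(huv i).2.1]

theorem div_prod_le_disc {d : ℕ} (hd : 1 ≤ d) (α : Fin d → ℝ) (h : Fin d → ℕ) (hh : ∀ i, 1 ≤ h i)
    (N : ℕ) (hN : (N : ℝ) * ‖((∑ i, (h i : ℝ) * α i : ℝ) : UnitAddCircle)‖ ≤ 1 / 4) :
    ∏ i, 1 / (4 * d * (h i : ℝ)) ≤ disc (fun n i => Int.fract (n * α i)) N := by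
  have hd' : (0 : ℝ) < d := by exact_mod_cast hd
  have hd1 : (1 : ℝ) ≤ d := by exact_mod_cast hd
  have hpos : ∀ i, (0 : ℝ) < h i := fun i => by exact_mod_cast hh i
  set u : Fin d → ℝ := fun i => 3 / (8 * d * h i) with hu
  set v : Fin d → ℝ := fun i => 5 / (8 * d * h i) with hv
  have hprod : ∏ i, 1 / (4 * d * (h i : ℝ)) = ∏ i, (v i - u i) := by
    refine Finset.prod_congr rfl fun i _ => ?_
    have := hpos i
    simp only [hu, hv]
    field_simp
    norm_num
  have hsum : ∀ c : ℝ, ∑ i, (h i : ℝ) * (c / (8 * d * h i)) = c / 8 := by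
    intro c
    rw [Finset.sum_congr rfl fun i _ => show (h i : ℝ) * (c / (8 * d * h i)) = c / (8 * d) by
      have := hpos i
      field_simp]
    simp only [Finset.sum_const, Finset.card_univ, Fintype.card_fin, nsmul_eq_mul]
    field_simp
  rw [hprod]
  refine prod_le_disc_of_avoid (fun i => ?_) fun n hn hbox => ?_
  · have := hpos i
    have h1 : (1 : ℝ) ≤ h i := by exact_mod_cast hh i
    refine ⟨by positivity, ?_, ?_⟩
    · simp only [hu, hv]; gcongr; norm_num
    · simp only [hv]
      rw [div_le_one (by positivity)]
      nlinarith
  set y : ℝ := ∑ i, (h i : ℝ) * α i with hy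
  set a : ℤ := round y with ha
  have hnorm : ‖(y : UnitAddCircle)‖ = |y - a| := UnitAddCircle.norm_eq
  have hsmall : |(n : ℝ) * (y - a)| ≤ 1 / 4 := by
    rw [abs_mul, Nat.abs_cast, ← hnorm]
    refine le_trans ?_ hN
    have : (n : ℝ) ≤ N := by exact_mod_cast hn.le
    gcongr
  set b : ℤ := n * a - ∑ i, (h i : ℤ) * ⌊(n : ℝ) * α i⌋ with hb
  have hval : ∑ i, (h i : ℝ) * Int.fract ((n : ℝ) * α i) = (n : ℝ) * (y - a) + b := by
    simp only [Int.fract, mul_sub, Finset.sum_sub_distrib, hb, hy, Finset.mul_sum]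
    push_cast
    rw [Finset.sum_congr rfl fun i _ => show (h i : ℝ) * (n * α i) = n * (h i * α i) by ring]
    ring
  have hlow : 3 / 8 ≤ ∑ i, (h i : ℝ) * Int.fract ((n : ℝ) * α i) := by
    rw [← hsum 3]
    exact Finset.sum_le_sum fun i _ => mul_le_mul_of_nonneg_left (hbox i).1 (hpos i).le
  have hup : ∑ i, (h i : ℝ) * Int.fract ((n : ℝ) * α i) ≤ 5 / 8 := by
    rw [← hsum 5]
    exact Finset.sum_le_sum fun i _ => mul_le_mul_of_nonneg_left (hbox i).2.le (hpos i).le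
  rw [hval] at hlow hup
  rw [abs_le] at hsmall
  have hb0 : (0 : ℝ) < b := by linarith
  have hb1 : (b : ℝ) < 1 := by linarith
  have hb0' : 0 < b := by exact_mod_cast hb0
  have hb1' : b < 1 := by exact_mod_cast hb1
  omega

theorem prod_le_two_pow_dyadicHeight {d : ℕ} (h : Fin d → ℕ) :
    ∏ i, (h i : ℝ) ≤ 2 ^ (dyadicHeight h + d) := by
  calc ∏ i, (h i : ℝ) ≤ ∏ i, (2 : ℝ) ^ (Nat.log 2 (h i) + 1) := by
        refine Finset.prod_le_prod (fun i _ => by positivity) fun i _ => ?_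
        exact_mod_cast (Nat.lt_pow_succ_log_self (by norm_num) (h i)).le
    _ = _ := by
        rw [Finset.prod_pow_eq_pow_sum, Finset.sum_add_distrib]
        simp [dyadicHeight]

theorem finite_setOf_dyadicHeight_lt {d : ℕ} (M : ℕ) :
    {h : Fin d → ℕ | dyadicHeight h < M}.Finite := by
  refine (Set.Finite.pi' fun _ : Fin d => Set.finite_Iio (2 ^ M)).subset fun h hh i => ?_
  refine (Nat.lt_pow_succ_log_self (b := 2) (by norm_num) (h i)).trans_le
    (Nat.pow_le_pow_right (by norm_num) ?_)
  have : Nat.log 2 (h i) ≤ dyadicHeight h :=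
    Finset.single_le_sum (f := fun i => Nat.log 2 (h i)) (fun _ _ => Nat.zero_le _)
      (Finset.mem_univ i)
  exact this.trans_lt hh

theorem exists_disc_lower_bound {d : ℕ} (hd : 1 ≤ d) (α : Fin d → ℝ)
    (hα : {h : Fin d → ℕ | (∀ i, 1 ≤ h i) ∧
      ‖((∑ i, (h i : ℝ) * α i : ℝ) : UnitAddCircle)‖ ≤ approxRate h}.Infinite) :
    ∃ C > 0, ∀ m : ℕ, ∃ N : ℕ, m ≤ N ∧
      C * log N ^ d * log (log N) / N ≤ disc (fun n i => Int.fract (n * α i)) N := by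
  have hd1 : (1 : ℝ) ≤ d := by exact_mod_cast hd
  have hd0 : (0 : ℝ) < d := by linarith
  set D : ℝ := (8 * (d + 2) ^ d * (2 * d + 5)) with hD
  have hDpos : 0 < D := by positivity
  set c : ℝ := (1 / (4 * d)) ^ d / 2 ^ d with hc
  have hcpos : 0 < c := by positivity
  refine ⟨c / D, by positivity, fun m => ?_⟩
  obtain ⟨h, ⟨hh, hε⟩, hbig⟩ := hα.exists_notMem_finite (finite_setOf_dyadicHeight_lt (16 + m))
  simp only [Set.mem_ofPred_eq, not_lt] at hbig
  set K := dyadicHeight h with hK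
  have hlog := half_lt_log_add_two K
  set l := log ((K : ℝ) + 2) with hl
  have hl0 : 0 < l := by linarith
  set R : ℝ := 2 ^ K * ((K : ℝ) + 2) ^ d * l with hR
  have hrate : approxRate h = 1 / R := rfl
  have hK16 : (16 : ℝ) + m ≤ K := by exact_mod_cast hbig
  have hRbig : (16 : ℝ) + m ≤ R / 4 := by
    have h1 : (K : ℝ) ≤ 2 ^ K := by exact_mod_cast Nat.lt_two_pow_self.le
    have h2 : (K : ℝ) + 2 ≤ ((K : ℝ) + 2) ^ d := le_self_pow₀ (by linarith) (by omega)
    have h3 : (K : ℝ) * (K + 2) * (1 / 2) ≤ R := by rw [hR]; gcongr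
    have : (0 : ℝ) ≤ m := by positivity
    nlinarith
  set N := ⌊R / 4⌋₊ with hN
  have hm0 : (0 : ℝ) ≤ m := by positivity
  have hNle : (N : ℝ) ≤ R / 4 := Nat.floor_le (by linarith)
  have hNge : R / 4 - 1 < N := Nat.sub_one_lt_floor _
  have hN8 : R / 8 ≤ N := by linarith
  have hNpos : (0 : ℝ) < N := by linarith
  have hN3 : (3 : ℝ) ≤ N := by linarith
  refine ⟨N, ?_, ?_⟩
  · have : (m : ℝ) ≤ N := by linarith
    exact_mod_cast this
  have hdisc := div_prod_le_disc hd α h hh N (by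
    calc (N : ℝ) * ‖((∑ i, (h i : ℝ) * α i : ℝ) : UnitAddCircle)‖ ≤ R / 4 * (1 / R) := by
          rw [← hrate]
          gcongr
      _ = 1 / 4 := by
          have : R ≠ 0 := by linarith
          field_simp)
  refine le_trans ?_ hdisc
  have hvol : c / 2 ^ K ≤ ∏ i, 1 / (4 * d * (h i : ℝ)) := by
    have h1 : ∏ i, 1 / (4 * d * (h i : ℝ)) = (1 / (4 * d)) ^ d / ∏ i, (h i : ℝ) := by
      rw [Finset.prod_congr rfl fun i _ => show 1 / (4 * d * (h i : ℝ)) = (1 / (4 * d)) / h i by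
        rw [div_div], Finset.prod_div_distrib]
      simp
    rw [h1, hc, div_div, ← pow_add, add_comm d]
    have : 0 < ∏ i, (h i : ℝ) := Finset.prod_pos fun i _ => by exact_mod_cast hh i
    gcongr
    exact prod_le_two_pow_dyadicHeight h
  refine le_trans ?_ hvol
  have hl_le : l ≤ K + 2 := (log_le_sub_one_of_pos (by linarith)).trans (by linarith)
  have hlogN : log N ≤ (d + 2) * ((K : ℝ) + 2) := by
    have h1 : (N : ℝ) ≤ 2 ^ K * ((K : ℝ) + 2) ^ (d + 1) := by
      refine hNle.trans ?_
      have : R ≤ 2 ^ K * ((K : ℝ) + 2) ^ (d + 1) := by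
        rw [hR, pow_succ, ← mul_assoc]; gcongr
      linarith
    calc log N ≤ log (2 ^ K * ((K : ℝ) + 2) ^ (d + 1)) := log_le_log hNpos h1
      _ = K * log 2 + (d + 1) * l := by
        rw [log_mul (by positivity) (by positivity), log_pow, log_pow]; push_cast; rfl
      _ ≤ K * 1 + (d + 1) * (K + 2) := by
        gcongr
        linarith [log_two_lt_d9]
      _ ≤ _ := by nlinarith
  have hlogN1 : 1 ≤ log N := by
    rw [le_log_iff_exp_le hNpos]
    linarith [exp_one_lt_d9]
  have hloglog : log (log N) ≤ (2 * d + 5) * l := by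
    calc log (log N) ≤ log ((d + 2) * ((K : ℝ) + 2)) := log_le_log (by linarith) hlogN
      _ = log (d + 2) + l := log_mul (by positivity) (by positivity)
      _ ≤ (d + 2) + l := by
        gcongr
        exact (log_le_sub_one_of_pos (by positivity)).trans (by linarith)
      _ ≤ _ := by nlinarith
  have hloglog0 : 0 ≤ log (log N) := log_nonneg hlogN1
  calc c / D * log N ^ d * log (log N) / N
      ≤ c / D * ((d + 2) * ((K : ℝ) + 2)) ^ d * ((2 * d + 5) * l) / (R / 8) := by gcongr
    _ = c / 2 ^ K := by
      rw [hD, hR, mul_pow]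
      field_simp

theorem setOf_infinite_mem_eq_iInter {Ω ι : Type*} (E : ι → Set Ω) :
    {x | {i | x ∈ E i}.Infinite} = ⋂ m : Finset ι, ⋃ i ∈ {i | i ∉ m}, E i := by
  ext x
  simp only [Set.mem_ofPred_eq, Set.mem_iInter, Set.mem_iUnion, exists_prop]
  constructor
  · intro hx m
    obtain ⟨i, hi, him⟩ := hx.exists_notMem_finset m
    exact ⟨i, him, hi⟩
  · intro hx hfin
    obtain ⟨i, hi, hxi⟩ := hx hfin.toFinset
    exact hi (by simpa using hxi)

theorem measurableSet_setOf_infinite_mem {Ω ι : Type*} [MeasurableSpace Ω] [Countable ι]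
    {E : ι → Set Ω} (hE : ∀ i, MeasurableSet (E i)) :
    MeasurableSet {x | {i | x ∈ E i}.Infinite} := by
  rw [setOf_infinite_mem_eq_iInter]
  exact MeasurableSet.iInter fun m => MeasurableSet.biUnion (Set.to_countable _) fun i _ => hE i

/-- A Kochen–Stone type bound: sets with non-summable measures that are quasi-independent on average
have a limit superior of measure at least `1 / C`. -/
theorem le_measureReal_infinite_of_quasiIndep {Ω ι : Type*} [MeasurableSpace Ω] [Countable ι]
    (μ : Measure Ω) [IsProbabilityMeasure μ] (E : ι → Set Ω) (hE : ∀ i, MeasurableSet (E i))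
    {C C' : ℝ} (hC : 0 < C) (hC' : 0 ≤ C')
    (h : ∀ (m : Finset ι) (L : ℝ), ∃ F : Finset ι, Disjoint F m ∧ L ≤ ∑ i ∈ F, μ.real (E i) ∧
      ∑ i ∈ F, ∑ j ∈ F, μ.real (E i ∩ E j) ≤
        C * (∑ i ∈ F, μ.real (E i)) ^ 2 + C' * ∑ i ∈ F, μ.real (E i)) :
    1 / C ≤ μ.real {x | {i | x ∈ E i}.Infinite} := by
  classical
  set U : Finset ι → Set Ω := fun m => ⋃ i ∈ {i | i ∉ m}, E i with hU
  have hUmeas : ∀ m, MeasurableSet (U m) := fun m =>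
    MeasurableSet.biUnion (Set.to_countable _) fun i _ => hE i
  have hanti : Antitone U := by
    intro m m' hmm
    refine Set.biUnion_subset_biUnion_left fun i hi hi' => hi (hmm hi')
  have hlim : {x | {i | x ∈ E i}.Infinite} = ⋂ m, U m := setOf_infinite_mem_eq_iInter E
  have key : ∀ m, 1 / C ≤ μ.real (U m) := by
    intro m
    have step : ∀ L : ℝ, 0 < L → 1 ≤ (C + C' / L) * μ.real (U m) := by
      intro L hL
      obtain ⟨F, hF, hLS, hsum⟩ := h m L
      set S := ∑ i ∈ F, μ.real (E i) with hS
      have hSpos : 0 < S := hL.trans_le hLS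
      set f : Ω → ℝ := fun x => ∑ i ∈ F, (E i).indicator 1 x with hf
      have hInd : ∀ A : Set Ω, MeasurableSet A → Integrable (A.indicator (1 : Ω → ℝ)) μ :=
        fun A hA => (integrable_const (1 : ℝ)).indicator hA
      have hfint : Integrable f μ := integrable_finsetSum _ fun i _ => hInd _ (hE i)
      have hfS : ∫ x, f x ∂μ = S := by
        rw [integral_finsetSum _ fun i _ => hInd _ (hE i)]
        exact Finset.sum_congr rfl fun i _ => integral_indicator_one (hE i)
      have hf2 : ∀ x, f x ^ 2 = ∑ i ∈ F, ∑ j ∈ F, (E i ∩ E j).indicator (1 : Ω → ℝ) x := by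
        intro x
        rw [hf, sq, Finset.sum_mul_sum]
        refine Finset.sum_congr rfl fun i _ => Finset.sum_congr rfl fun j _ => ?_
        rw [Set.inter_indicator_one]; rfl
      have hf2int : Integrable (fun x => f x ^ 2) μ := by
        simp only [hf2]
        exact integrable_finsetSum _ fun i _ => integrable_finsetSum _ fun j _ =>
          hInd _ ((hE i).inter (hE j))
      have hf2S : ∫ x, f x ^ 2 ∂μ = ∑ i ∈ F, ∑ j ∈ F, μ.real (E i ∩ E j) := by
        simp only [hf2]
        rw [integral_finsetSum _ fun i _ => integrable_finsetSum _ fun j _ =>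
          hInd _ ((hE i).inter (hE j))]
        refine Finset.sum_congr rfl fun i _ => ?_
        rw [integral_finsetSum _ fun j _ => hInd _ ((hE i).inter (hE j))]
        exact Finset.sum_congr rfl fun j _ => integral_indicator_one ((hE i).inter (hE j))
      have hpt : ∀ t x, 2 * t * f x ≤ f x ^ 2 + t ^ 2 * (U m).indicator 1 x := by
        intro t x
        by_cases hx : x ∈ U m
        · simp only [Set.indicator_of_mem hx, Pi.one_apply]
          nlinarith [sq_nonneg (f x - t)]
        · have : f x = 0 := by
            refine Finset.sum_eq_zero fun i hi => Set.indicator_of_notMem (fun hxi => hx ?_) _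
            simp only [hU, Set.mem_iUnion, exists_prop, Set.mem_ofPred_eq]
            exact ⟨i, Finset.disjoint_left.1 hF hi, hxi⟩
          simp [this, Set.indicator_of_notMem hx]
      have hmain : ∀ t, 2 * t * S ≤ (C * S ^ 2 + C' * S) + t ^ 2 * μ.real (U m) := by
        intro t
        calc 2 * t * S = ∫ x, 2 * t * f x ∂μ := by rw [integral_const_mul, hfS]
          _ ≤ ∫ x, (f x ^ 2 + t ^ 2 * (U m).indicator 1 x) ∂μ :=
            integral_mono (hfint.const_mul _) (hf2int.add ((hInd _ (hUmeas m)).const_mul _)) (hpt t)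
          _ = ∑ i ∈ F, ∑ j ∈ F, μ.real (E i ∩ E j) + t ^ 2 * μ.real (U m) := by
            rw [integral_add hf2int ((hInd _ (hUmeas m)).const_mul _), hf2S, integral_const_mul,
              integral_indicator_one (hUmeas m)]
          _ ≤ _ := by gcongr
      have h1 := hmain (C * S + C')
      have hpos : 0 < C * S + C' := by positivity
      have h2 : S ≤ (C * S + C') * μ.real (U m) := by
        have : (C * S + C') * S ≤ (C * S + C') * ((C * S + C') * μ.real (U m)) := by nlinarith
        exact le_of_mul_le_mul_left this hpos
      have h3 : 1 ≤ (C + C' / S) * μ.real (U m) := by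
        have : (C + C' / S) * μ.real (U m) = ((C * S + C') * μ.real (U m)) / S := by
          field_simp
        rw [this, le_div_iff₀ hSpos]; linarith
      refine h3.trans ?_
      gcongr
    have hle : Filter.Tendsto (fun L : ℝ => (C + C' / L) * μ.real (U m)) Filter.atTop
        (nhds ((C + 0) * μ.real (U m))) :=
      ((tendsto_const_nhds.add (tendsto_const_nhds.div_atTop Filter.tendsto_id)).mul_const _)
    have := ge_of_tendsto hle (Filter.eventually_atTop.2 ⟨1, fun L hL => step L (by linarith)⟩)
    rw [div_le_iff₀ hC]
    linarith
  rw [hlim, measureReal_def, hanti.directed_ge.measure_iInter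
    (fun m => (hUmeas m).nullMeasurableSet) ⟨∅, measure_ne_top _ _⟩]
  rw [ENNReal.toReal_iInf fun m => measure_ne_top _ _]
  exact le_ciInf key

theorem sum_totient_div (X : ℕ) :
    ∑ g ∈ Finset.Ioc 0 X, ∑ q ∈ Finset.Ioc 0 (X / g), q.totient = ∑ q ∈ Finset.Ioc 0 X, q := by
  obtain ⟨φ, hφ⟩ : ∃ φ : ArithmeticFunction ℕ, ∀ n, φ n = n.totient :=
    ⟨⟨Nat.totient, Nat.totient_zero⟩, fun _ => rfl⟩
  have h := ArithmeticFunction.sum_Ioc_mul_eq_sum_sum ArithmeticFunction.zeta φ X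
  calc _ = ∑ g ∈ Finset.Ioc 0 X, ArithmeticFunction.zeta g *
        ∑ q ∈ Finset.Ioc 0 (X / g), φ q := by
        refine Finset.sum_congr rfl fun g hg => ?_
        rw [ArithmeticFunction.zeta_apply_ne (Finset.mem_Ioc.1 hg).1.ne', one_mul]
        simp only [hφ]
    _ = _ := by
        rw [← h]
        refine Finset.sum_congr rfl fun q _ => ?_
        have := ArithmeticFunction.coe_zeta_mul_apply (f := φ) (x := q)
        simp only [ArithmeticFunction.natCoe_nat] at this
        rw [this]
        simp only [hφ, Nat.sum_totient]

theorem sum_totient_le (X : ℕ) :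
    ((∑ q ∈ Finset.Ioc 0 X, q.totient : ℕ) : ℝ) ≤ ((X : ℝ) ^ 2 + 1) / 2 := by
  rcases X with _ | X
  · simp
  induction X with
  | zero => simp
  | succ X ih =>
    rw [← Finset.insert_Ioc_right_eq_Ioc_add_one (by omega), Finset.sum_insert (by simp)]
    have : (Nat.totient (X + 1 + 1)) ≤ X + 1 := by
      have := Nat.totient_lt (X + 1 + 1) (by omega); omega
    have : ((Nat.totient (X + 1 + 1) : ℕ) : ℝ) ≤ X + 1 := by exact_mod_cast this
    push_cast at *
    nlinarith

theorem sq_div_six_le_sum_totient (X : ℕ) :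
    (X : ℝ) ^ 2 / 6 ≤ ((∑ q ∈ Finset.Ioc 0 X, q.totient : ℕ) : ℝ) := by
  rcases Nat.eq_zero_or_pos X with rfl | hX
  · simp
  have htel : ∀ n : ℕ, 1 ≤ n →
      ∑ g ∈ Finset.Ioc 1 n, 1 / (g : ℝ) ^ 2 ≤ 2 / 3 - 1 / ((n : ℝ) + 1 / 2) := by
    intro n hn
    induction n, hn using Nat.le_induction with
    | base => norm_num
    | succ n hn ih =>
      rw [← Finset.insert_Ioc_right_eq_Ioc_add_one (by omega), Finset.sum_insert (by simp)]
      have hn0 : (0 : ℝ) < n := by exact_mod_cast hn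
      have : 1 / ((n : ℝ) + 1) ^ 2 ≤ 1 / ((n : ℝ) + 1 / 2) - 1 / ((n : ℝ) + 1 + 1 / 2) := by
        rw [div_sub_div _ _ (by positivity) (by positivity),
          div_le_div_iff₀ (by positivity) (by positivity)]
        nlinarith
      push_cast
      linarith
  have hsum : ((∑ q ∈ Finset.Ioc 0 X, q : ℕ) : ℝ) = X * (X + 1) / 2 := by
    clear hX htel
    induction X with
    | zero => simp
    | succ X ih =>
      rw [← Finset.insert_Ioc_right_eq_Ioc_add_one (by omega), Finset.sum_insert (by simp)]
      push_cast at *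
      rw [ih]; ring
  have hsplit := sum_totient_div X
  have hIoc : Finset.Ioc 0 X = insert 1 (Finset.Ioc 1 X) := by
    ext g; simp only [Finset.mem_Ioc, Finset.mem_insert]; omega
  nth_rewrite 1 [hIoc] at hsplit
  rw [Finset.sum_insert (by simp), Nat.div_one] at hsplit
  have hb : ((∑ g ∈ Finset.Ioc 1 X, ∑ q ∈ Finset.Ioc 0 (X / g), q.totient : ℕ) : ℝ) ≤
      (X : ℝ) ^ 2 / 3 + X / 2 - 1 / 2 := by
    calc ((∑ g ∈ Finset.Ioc 1 X, ∑ q ∈ Finset.Ioc 0 (X / g), q.totient : ℕ) : ℝ)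
        ≤ ∑ g ∈ Finset.Ioc 1 X, ((X : ℝ) ^ 2 / 2 * (1 / (g : ℝ) ^ 2) + 1 / 2) := by
          rw [Nat.cast_sum]
          refine Finset.sum_le_sum fun g hg => (sum_totient_le _).trans ?_
          have h1 : ((X / g : ℕ) : ℝ) ≤ X / g := Nat.cast_div_le
          have h2 : ((X / g : ℕ) : ℝ) ^ 2 ≤ (X / g : ℝ) ^ 2 := by gcongr
          have h3 : (X / g : ℝ) ^ 2 = X ^ 2 * (1 / (g : ℝ) ^ 2) := by ring
          linarith
      _ = (X : ℝ) ^ 2 / 2 * ∑ g ∈ Finset.Ioc 1 X, 1 / (g : ℝ) ^ 2 + (X - 1) / 2 := by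
          rw [Finset.sum_add_distrib, Finset.mul_sum]
          simp only [Finset.sum_const, Nat.card_Ioc, nsmul_eq_mul, Nat.cast_sub hX]
          push_cast; ring
      _ ≤ (X : ℝ) ^ 2 / 2 * (2 / 3) + (X - 1) / 2 := by
          gcongr
          refine (htel X hX).trans ?_
          have : (0 : ℝ) ≤ 1 / (X + 1 / 2) := by positivity
          linarith
      _ = _ := by ring
  have hc : ((∑ q ∈ Finset.Ioc 0 X, q.totient : ℕ) : ℝ) +
      ((∑ g ∈ Finset.Ioc 1 X, ∑ q ∈ Finset.Ioc 0 (X / g), q.totient : ℕ) : ℝ) =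
      X * (X + 1) / 2 := by
    rw [← hsum, ← hsplit]; push_cast; rfl
  have hX1 : (1 : ℝ) ≤ X := by exact_mod_cast hX
  nlinarith

theorem four_pow_div_six_le_sum_totient (k : ℕ) :
    (4 : ℝ) ^ k / 6 ≤ ((∑ q ∈ Finset.Ico (2 ^ k) (2 ^ (k + 1)), q.totient : ℕ) : ℝ) := by
  rcases Nat.lt_or_ge k 2 with hk | hk
  · interval_cases k
    · norm_num
    · rw [show Finset.Ico (2 ^ 1) (2 ^ (1 + 1)) = {2, 3} by decide]
      norm_num [Nat.totient_prime Nat.prime_three]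
  obtain ⟨Q, hQ⟩ : ∃ Q, 2 ^ k = Q + 1 := ⟨2 ^ k - 1, by have := Nat.one_le_two_pow (n := k); omega⟩
  have hQ3 : 3 ≤ Q := by
    have : 2 ^ 2 ≤ 2 ^ k := Nat.pow_le_pow_right (by norm_num) hk
    omega
  have h4 : (4 : ℝ) ^ k = (Q + 1) ^ 2 := by
    have : ((2 ^ k : ℕ) : ℝ) = Q + 1 := by rw [hQ]; push_cast; ring
    rw [← this]; push_cast; rw [← pow_mul, mul_comm, pow_mul]; norm_num
  have hI : Finset.Ico (2 ^ k) (2 ^ (k + 1)) = Finset.Ioc Q (2 * Q + 1) := by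
    ext q; simp only [Finset.mem_Ico, Finset.mem_Ioc, pow_succ, hQ]; omega
  have hs : ∑ q ∈ Finset.Ioc 0 (2 * Q + 1), q.totient =
      ∑ q ∈ Finset.Ioc 0 Q, q.totient + ∑ q ∈ Finset.Ioc Q (2 * Q + 1), q.totient :=
    (Finset.sum_Ioc_consecutive _ (by omega) (by omega)).symm
  have h1 := sq_div_six_le_sum_totient (2 * Q + 1)
  have h2 := sum_totient_le Q
  rw [hs] at h1
  rw [hI, h4]
  have : (3 : ℝ) ≤ Q := by exact_mod_cast hQ3
  push_cast at *
  nlinarith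

instance isProbabilityMeasure_unitAddCircle :
    IsProbabilityMeasure (volume : Measure UnitAddCircle) := ⟨UnitAddCircle.measure_univ⟩

theorem measurePreserving_sum_nsmul {ι : Type*} [Fintype ι] {h : ι → ℕ} {i : ι} (hi : h i ≠ 0) :
    MeasurePreserving (fun x : ι → UnitAddCircle => ∑ i, h i • x i) := by
  classical
  let f : (ι → UnitAddCircle) →+ UnitAddCircle :=
    { toFun := fun x => ∑ i, h i • x i
      map_zero' := by simp
      map_add' := fun x y => by simp [smul_add, Finset.sum_add_distrib] }
  have hf : ∀ x, f x = ∑ i, h i • x i := fun _ => rfl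
  refine f.measurePreserving (by simp only [funext hf]; fun_prop) (fun y => ?_) (by simp)
  obtain ⟨t, rfl⟩ := QuotientAddGroup.mk_surjective y
  refine ⟨Pi.single i ((t / h i : ℝ) : UnitAddCircle), ?_⟩
  rw [hf, Finset.sum_eq_single i (fun j _ hj => by simp [Pi.single_eq_of_ne hj]) (by simp),
    Pi.single_eq_same, ← AddCircle.coe_nsmul, nsmul_eq_mul,
    mul_div_cancel₀ _ (by exact_mod_cast hi)]

theorem measurePreserving_sum_nsmul_prodMk {ι : Type*} [Fintype ι] {h h' : ι → ℕ} {i j : ι}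
    (hij : h i * h' j ≠ h j * h' i) :
    MeasurePreserving (fun x : ι → UnitAddCircle => (∑ i, h i • x i, ∑ i, h' i • x i))
      volume ((volume : Measure UnitAddCircle).prod volume) := by
  classical
  have hne : i ≠ j := by rintro rfl; exact hij rfl
  let f : (ι → UnitAddCircle) →+ UnitAddCircle × UnitAddCircle :=
    { toFun := fun x => (∑ i, h i • x i, ∑ i, h' i • x i)
      map_zero' := by simp
      map_add' := fun x y => by simp [smul_add, Finset.sum_add_distrib] }
  have hf : ∀ x, f x = (∑ i, h i • x i, ∑ i, h' i • x i) := fun _ => rfl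
  refine f.measurePreserving (by simp only [funext hf]; fun_prop) (fun y => ?_)
    (by simp [volume_pi])
  obtain ⟨y, y'⟩ := y
  obtain ⟨s, rfl⟩ := QuotientAddGroup.mk_surjective y
  obtain ⟨t, rfl⟩ := QuotientAddGroup.mk_surjective y'
  set D : ℝ := (h i : ℝ) * h' j - h j * h' i with hD
  have hD0 : D ≠ 0 := by
    rw [hD, sub_ne_zero]; exact_mod_cast hij
  set a : ℝ := (s * h' j - t * h j) / D with ha
  set b : ℝ := (t * h i - s * h' i) / D with hb
  have hsum : ∀ g : ι → ℕ, ∑ k, g k • (Pi.single i (a : UnitAddCircle) +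
      Pi.single j (b : UnitAddCircle) : ι → UnitAddCircle) k =
      ((g i * a + g j * b : ℝ) : UnitAddCircle) := by
    intro g
    simp only [Pi.add_apply, smul_add, Finset.sum_add_distrib]
    rw [Finset.sum_eq_single i (fun k _ hk => by simp [Pi.single_eq_of_ne hk]) (by simp),
      Finset.sum_eq_single j (fun k _ hk => by simp [Pi.single_eq_of_ne hk]) (by simp),
      Pi.single_eq_same, Pi.single_eq_same, AddCircle.coe_add, ← AddCircle.coe_nsmul,
      ← AddCircle.coe_nsmul, nsmul_eq_mul, nsmul_eq_mul]
  refine ⟨Pi.single i (a : UnitAddCircle) + Pi.single j (b : UnitAddCircle), ?_⟩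
  rw [hf, hsum, hsum]
  congr 3
  · rw [ha, hb]; field_simp; rw [hD]; ring
  · rw [ha, hb]; field_simp; rw [hD]; ring

theorem measureReal_norm_sum_nsmul_le {ι : Type*} [Fintype ι] {h : ι → ℕ} {i : ι} (hi : h i ≠ 0)
    {r : ℝ} (hr : 0 ≤ r) (hr' : 2 * r ≤ 1) :
    (volume : Measure (ι → UnitAddCircle)).real {x | ‖∑ i, h i • x i‖ ≤ r} = 2 * r := by
  have hset : {x : ι → UnitAddCircle | ‖∑ i, h i • x i‖ ≤ r} =
      (fun x => ∑ i, h i • x i) ⁻¹' Metric.closedBall 0 r := by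
    ext x; simp
  rw [hset, (measurePreserving_sum_nsmul hi).measureReal_preimage
    Metric.isClosed_closedBall.measurableSet.nullMeasurableSet, measureReal_def,
    AddCircle.volume_closedBall, min_eq_right hr', ENNReal.toReal_ofReal (by linarith)]

theorem measureReal_inter_norm_sum_nsmul_le {ι : Type*} [Fintype ι] {h h' : ι → ℕ} {i j : ι}
    (hij : h i * h' j ≠ h j * h' i) {r r' : ℝ} (hr : 0 ≤ r) (hr' : 2 * r ≤ 1)
    (hs : 0 ≤ r') (hs' : 2 * r' ≤ 1) :
    (volume : Measure (ι → UnitAddCircle)).real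
      ({x | ‖∑ i, h i • x i‖ ≤ r} ∩ {x | ‖∑ i, h' i • x i‖ ≤ r'}) = (2 * r) * (2 * r') := by
  have hset : {x : ι → UnitAddCircle | ‖∑ i, h i • x i‖ ≤ r} ∩ {x | ‖∑ i, h' i • x i‖ ≤ r'} =
      (fun x => (∑ i, h i • x i, ∑ i, h' i • x i)) ⁻¹'
        (Metric.closedBall 0 r ×ˢ Metric.closedBall 0 r') := by
    ext x; simp
  rw [hset, (measurePreserving_sum_nsmul_prodMk hij).measureReal_preimage
    (Metric.isClosed_closedBall.measurableSet.prod
      Metric.isClosed_closedBall.measurableSet).nullMeasurableSet,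
    measureReal_prod_prod, measureReal_def, measureReal_def,
    AddCircle.volume_closedBall, AddCircle.volume_closedBall, min_eq_right hr', min_eq_right hs',
    ENNReal.toReal_ofReal (by linarith), ENNReal.toReal_ofReal (by linarith)]

theorem exists_disjoint_le_sum_of_not_summable {ι : Type*} {f : ι → ℝ} (hf : ∀ i, 0 ≤ f i)
    (h : ¬ Summable f) (m : Finset ι) (L : ℝ) :
    ∃ F : Finset ι, Disjoint F m ∧ L ≤ ∑ i ∈ F, f i := by
  classical
  by_contra! hcon
  refine h (summable_of_sum_le (c := L + ∑ i ∈ m, f i) hf fun F => ?_)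
  rw [← Finset.sum_inter_add_sum_sdiff F m, add_comm]
  exact add_le_add (hcon _ Finset.sdiff_disjoint).le
    (Finset.sum_le_sum_of_subset_of_nonneg Finset.inter_subset_right fun i _ _ => hf i)

theorem sum_Ico_inv_two_pow_log {s t : ℕ} (hst : s ≤ t) :
    ∑ a ∈ Finset.Ico (2 ^ s) (2 ^ t), ((2 : ℝ) ^ Nat.log 2 a)⁻¹ = t - s := by
  induction t, hst using Nat.le_induction with
  | base => simp
  | succ t hst ih =>
    rw [← Finset.sum_Ico_consecutive _ (Nat.pow_le_pow_right (by norm_num) hst)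
      (Nat.pow_le_pow_right (by norm_num) t.le_succ), ih]
    have : ∀ a ∈ Finset.Ico (2 ^ t) (2 ^ (t + 1)), ((2 : ℝ) ^ Nat.log 2 a)⁻¹ = (2 ^ t)⁻¹ := by
      intro a ha
      rw [Finset.mem_Ico] at ha
      rw [Nat.log_eq_of_pow_le_of_lt_pow ha.1 ha.2]
    rw [Finset.sum_congr rfl this, Finset.sum_const, Nat.card_Ico, pow_succ, mul_two,
      Nat.add_sub_cancel, nsmul_eq_mul]
    push_cast
    rw [mul_inv_cancel₀ (by positivity)]
    ring

theorem approxRate_pos {d : ℕ} (h : Fin d → ℕ) : 0 < approxRate h := by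
  have := half_lt_log_add_two (dyadicHeight h)
  have : 0 < log ((dyadicHeight h : ℝ) + 2) := by linarith
  unfold approxRate
  positivity

theorem le_approxRate {d K : ℕ} {h : Fin d → ℕ} (hK : dyadicHeight h ≤ K) :
    1 / (((K : ℝ) + 2) ^ d * log ((K : ℝ) + 2)) * (2 ^ dyadicHeight h)⁻¹ ≤ approxRate h := by
  have := half_lt_log_add_two (dyadicHeight h)
  have hl : 0 < log ((dyadicHeight h : ℝ) + 2) := by linarith
  have hK' : (dyadicHeight h : ℝ) ≤ K := by exact_mod_cast hK
  have hll : log ((dyadicHeight h : ℝ) + 2) ≤ log ((K : ℝ) + 2) :=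
    log_le_log (by positivity) (by linarith)
  rw [approxRate, ← one_div, div_mul_div_comm, one_mul, mul_comm _ ((2 : ℝ) ^ _), ← mul_assoc]
  gcongr

theorem le_sum_approxRate {d : ℕ} (m : ℕ) :
    1 / ((2 * (d + 1)) ^ d * (d + 1)) * (1 / ((m : ℝ) + 1)) ≤
      ∑ h ∈ Fintype.piFinset fun _ : Fin d => Finset.Ico (2 ^ 2 ^ m) (2 ^ 2 ^ (m + 1)),
        approxRate h := by
  set K := d * 2 ^ (m + 1) with hK
  have hlogK := half_lt_log_add_two K
  have hlogK0 : 0 < log ((K : ℝ) + 2) := by linarith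
  have hheight : ∀ h ∈ Fintype.piFinset fun _ : Fin d => Finset.Ico (2 ^ 2 ^ m) (2 ^ 2 ^ (m + 1)),
      dyadicHeight h ≤ K := by
    intro h hh
    have : ∀ i ∈ Finset.univ, Nat.log 2 (h i) ≤ 2 ^ (m + 1) := fun i _ =>
      (Nat.log_lt_of_lt_pow' (by positivity) (Finset.mem_Ico.1 (Fintype.mem_piFinset.1 hh i)).2).le
    simpa [dyadicHeight] using Finset.sum_le_card_nsmul _ _ _ this
  have hsum : ∑ h ∈ Fintype.piFinset fun _ : Fin d => Finset.Ico (2 ^ 2 ^ m) (2 ^ 2 ^ (m + 1)),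
      ((2 : ℝ) ^ dyadicHeight h)⁻¹ = (2 ^ m) ^ d := by
    have := Finset.prod_univ_sum (fun _ : Fin d => Finset.Ico (2 ^ 2 ^ m) (2 ^ 2 ^ (m + 1)))
      (fun _ a => ((2 : ℝ) ^ Nat.log 2 a)⁻¹)
    rw [sum_Ico_inv_two_pow_log (Nat.pow_le_pow_right (by norm_num) m.le_succ)] at this
    simp only [Finset.prod_const, Finset.card_univ, Fintype.card_fin] at this
    rw [show (((2 ^ (m + 1) : ℕ) : ℝ) - ((2 ^ m : ℕ) : ℝ)) = 2 ^ m by push_cast; ring] at this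
    rw [this]
    refine Finset.sum_congr rfl fun h _ => ?_
    rw [Finset.prod_inv_distrib, Finset.prod_pow_eq_pow_sum, dyadicHeight]
  have hX : (K : ℝ) + 2 ≤ (d + 1) * 2 ^ (m + 1) := by
    have : (1 : ℝ) ≤ 2 ^ m := one_le_pow₀ (by norm_num)
    rw [hK]; push_cast; rw [pow_succ]; nlinarith
  have hlogX : log ((K : ℝ) + 2) ≤ (d + 1) * (m + 1) := by
    calc log ((K : ℝ) + 2) ≤ log ((d + 1) * 2 ^ (m + 1)) := log_le_log (by positivity) hX
      _ = log (d + 1) + (m + 1) * log 2 := by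
        rw [log_mul (by positivity) (by positivity), log_pow]; push_cast; rfl
      _ ≤ d + (m + 1) * 1 := by
        gcongr
        · exact (log_le_sub_one_of_pos (by positivity)).trans (by linarith)
        · linarith [log_two_lt_d9]
      _ ≤ _ := by
        have : (0 : ℝ) ≤ d * m := by positivity
        nlinarith
  calc 1 / ((2 * (d + 1)) ^ d * (d + 1)) * (1 / ((m : ℝ) + 1))
      = 1 / (((d + 1) * 2 ^ (m + 1)) ^ d * ((d + 1) * (m + 1))) * (2 ^ m) ^ d := by
        rw [pow_succ, show ((d : ℝ) + 1) * (2 ^ m * 2) = (2 * (d + 1)) * 2 ^ m by ring,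
          mul_pow _ ((2 : ℝ) ^ m)]
        field_simp
    _ ≤ 1 / (((K : ℝ) + 2) ^ d * log ((K : ℝ) + 2)) * (2 ^ m) ^ d := by gcongr
    _ = ∑ h ∈ Fintype.piFinset fun _ : Fin d => Finset.Ico (2 ^ 2 ^ m) (2 ^ 2 ^ (m + 1)),
        1 / (((K : ℝ) + 2) ^ d * log ((K : ℝ) + 2)) * (2 ^ dyadicHeight h)⁻¹ := by
        rw [← Finset.mul_sum, hsum]
    _ ≤ _ := Finset.sum_le_sum fun h hh => le_approxRate (hheight h hh)

theorem not_summable_approxRate {d : ℕ} (hd : 1 ≤ d) :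
    ¬ Summable fun h : {h : Fin d → ℕ | ∀ i, 1 ≤ h i} => approxRate (h : Fin d → ℕ) := by
  intro hs
  set S : Set (Fin d → ℕ) := {h | ∀ i, 1 ≤ h i} with hS
  have hs' : Summable (S.indicator approxRate) := summable_subtype_iff_indicator.1 hs
  have hnn : ∀ h, 0 ≤ S.indicator approxRate h := fun h =>
    Set.indicator_nonneg (fun h _ => (approxRate_pos h).le) h
  set A : ℕ → Finset (Fin d → ℕ) := fun m =>
    Fintype.piFinset fun _ => Finset.Ico (2 ^ 2 ^ m) (2 ^ 2 ^ (m + 1)) with hA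
  have hAS : ∀ m, ∀ h ∈ A m, h ∈ S := fun m h hh i =>
    Nat.one_le_two_pow.trans (Finset.mem_Ico.1 (Fintype.mem_piFinset.1 hh i)).1
  have hdisj : ∀ m n, m < n → Disjoint (A m) (A n) := by
    intro m n hmn
    rw [Finset.disjoint_left]
    intro h hm hn
    have h1 := (Finset.mem_Ico.1 (Fintype.mem_piFinset.1 hm ⟨0, hd⟩)).2
    have h2 := (Finset.mem_Ico.1 (Fintype.mem_piFinset.1 hn ⟨0, hd⟩)).1
    have : 2 ^ 2 ^ (m + 1) ≤ 2 ^ 2 ^ n :=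
      Nat.pow_le_pow_right (by norm_num) (Nat.pow_le_pow_right (by norm_num) hmn)
    omega
  set c : ℝ := 1 / ((2 * (d + 1)) ^ d * (d + 1)) with hc
  have hcpos : 0 < c := by positivity
  have hharm : Summable fun m : ℕ => c * (1 / ((m : ℝ) + 1)) := by
    refine summable_of_sum_range_le (c := ∑' h, S.indicator approxRate h)
      (fun m => by positivity) fun M => ?_
    calc ∑ m ∈ Finset.range M, c * (1 / ((m : ℝ) + 1))
        ≤ ∑ m ∈ Finset.range M, ∑ h ∈ A m, S.indicator approxRate h := by
          refine Finset.sum_le_sum fun m _ => (le_sum_approxRate m).trans_eq ?_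
          exact Finset.sum_congr rfl fun h hh => (Set.indicator_of_mem (hAS m h hh) _).symm
      _ = ∑ h ∈ (Finset.range M).biUnion A, S.indicator approxRate h := by
          refine (Finset.sum_biUnion fun m _ n _ hmn => ?_).symm
          rcases lt_or_gt_of_ne hmn with h | h
          · exact hdisj m n h
          · exact (hdisj n m h).symm
      _ ≤ _ := hs'.sum_le_tsum _ fun h _ => hnn h
  have h1 : Summable fun m : ℕ => 1 / ((m : ℝ) + 1) := (summable_mul_left_iff hcpos.ne').1 hharm
  have h2 : Summable fun m : ℕ => 1 / ((m : ℝ)) := by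
    rw [← summable_nat_add_iff 1]
    simpa using h1
  exact Real.not_summable_one_div_natCast h2

theorem approxRate_mul_le {d g : ℕ} (hg : 1 ≤ g) {p : Fin d → ℕ} (hp : ∀ i, 1 ≤ p i) :
    approxRate (fun i => g * p i) ≤ 2 ^ d * (1 / (g : ℝ) ^ d) * approxRate p := by
  have hK : dyadicHeight p + d * Nat.log 2 g ≤ dyadicHeight fun i => g * p i := by
    calc dyadicHeight p + d * Nat.log 2 g = ∑ i, (Nat.log 2 (p i) + Nat.log 2 g) := by
          simp [dyadicHeight, Finset.sum_add_distrib]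
      _ ≤ _ := Finset.sum_le_sum fun i _ => by
          refine Nat.le_log_of_pow_le (by norm_num) ?_
          rw [pow_add, mul_comm]
          exact Nat.mul_le_mul (Nat.pow_log_le_self 2 (by omega))
            (Nat.pow_log_le_self 2 (by have := hp i; omega))
  have hlog := half_lt_log_add_two (dyadicHeight p)
  have hl : 0 < log ((dyadicHeight p : ℝ) + 2) := by linarith
  have hle : (dyadicHeight p : ℝ) ≤ dyadicHeight fun i => g * p i := by
    exact_mod_cast le_trans (Nat.le_add_right _ _) hK
  have hpow : (2 : ℝ) ^ dyadicHeight p * (g / 2) ^ d ≤ 2 ^ dyadicHeight fun i => g * p i := by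
    calc (2 : ℝ) ^ dyadicHeight p * (g / 2) ^ d
        ≤ 2 ^ dyadicHeight p * (2 ^ Nat.log 2 g) ^ d := by
          gcongr
          rw [div_le_iff₀ (by norm_num), ← pow_succ]
          exact_mod_cast (Nat.lt_pow_succ_log_self (by norm_num) g).le
      _ = 2 ^ (dyadicHeight p + d * Nat.log 2 g) := by rw [pow_add, ← pow_mul, mul_comm d]
      _ ≤ _ := pow_le_pow_right₀ (by norm_num) hK
  have hg0 : (0 : ℝ) < g := by exact_mod_cast hg
  calc approxRate (fun i => g * p i)
      ≤ 1 / ((2 : ℝ) ^ dyadicHeight p * (g / 2) ^ d * ((dyadicHeight p : ℝ) + 2) ^ d *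
        log ((dyadicHeight p : ℝ) + 2)) := by
        rw [approxRate]
        gcongr
    _ = _ := by
        rw [approxRate, div_pow]
        field_simp

theorem not_summable_approxRate_primitive {d : ℕ} (hd : 2 ≤ d) :
    ¬ Summable fun h : {h : Fin d → ℕ // (∀ i, 1 ≤ h i) ∧ Finset.univ.gcd h = 1} =>
      approxRate (h : Fin d → ℕ) := by
  intro hs
  have ha : Summable fun g : ℕ => (2 : ℝ) ^ d * (1 / (g : ℝ) ^ d) :=
    (Real.summable_one_div_nat_pow.2 (by omega)).mul_left _
  have hprod := ha.mul_of_nonneg hs (fun g => by positivity) fun h => (approxRate_pos _).le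
  have hgcd : ∀ h : {h : Fin d → ℕ | ∀ i, 1 ≤ h i}, 1 ≤ Finset.univ.gcd (h : Fin d → ℕ) := by
    intro h
    refine Nat.one_le_iff_ne_zero.2 fun h0 => ?_
    have := Finset.gcd_eq_zero_iff.1 h0 ⟨0, by omega⟩ (Finset.mem_univ _)
    have := h.2 ⟨0, by omega⟩
    omega
  have hdvd : ∀ (h : Fin d → ℕ) i, Finset.univ.gcd h * (h i / Finset.univ.gcd h) = h i :=
    fun h i => Nat.mul_div_cancel' (Finset.gcd_dvd (Finset.mem_univ i))
  have hquot : ∀ h : {h : Fin d → ℕ | ∀ i, 1 ≤ h i},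
      (∀ i, 1 ≤ (h : Fin d → ℕ) i / Finset.univ.gcd (h : Fin d → ℕ)) ∧
      (Finset.univ.gcd fun i => (h : Fin d → ℕ) i / Finset.univ.gcd (h : Fin d → ℕ)) = 1 := by
    intro h
    refine ⟨fun i => Nat.one_le_iff_ne_zero.2 fun h0 => ?_, ?_⟩
    · have h1 := hdvd h i
      have h2 := h.2 i
      rw [h0] at h1
      omega
    · refine Finset.gcd_div_eq_one (Finset.mem_univ (⟨0, by omega⟩ : Fin d)) ?_
      have := h.2 ⟨0, by omega⟩
      omega
  let φ : {h : Fin d → ℕ | ∀ i, 1 ≤ h i} →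
      ℕ × {h : Fin d → ℕ // (∀ i, 1 ≤ h i) ∧ Finset.univ.gcd h = 1} := fun h =>
    (Finset.univ.gcd (h : Fin d → ℕ), ⟨_, hquot h⟩)
  have hφ : Function.Injective φ := by
    intro h h' hhh
    simp only [φ, Prod.mk.injEq, Subtype.mk.injEq] at hhh
    refine Subtype.ext (funext fun i => ?_)
    rw [← hdvd h i, ← hdvd h' i, congrFun hhh.2 i, hhh.1]
  refine not_summable_approxRate (by omega : 1 ≤ d)
    ((hprod.comp_injective hφ).of_nonneg_of_le (fun h => (approxRate_pos _).le) fun h => ?_)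
  have := approxRate_mul_le (hgcd h) (hquot h).1
  simp only [hdvd] at this
  exact this

theorem two_mul_approxRate_le_one {d : ℕ} (hd : 2 ≤ d) (h : Fin d → ℕ) : 2 * approxRate h ≤ 1 := by
  have hlog := half_lt_log_add_two (dyadicHeight h)
  have h1 : (1 : ℝ) * 2 ^ 2 * (1 / 2) ≤ 2 ^ dyadicHeight h * ((dyadicHeight h : ℝ) + 2) ^ d *
      log ((dyadicHeight h : ℝ) + 2) := by
    gcongr
    · exact one_le_pow₀ (by norm_num)
    · calc (2 : ℝ) ^ 2 ≤ 2 ^ d := pow_le_pow_right₀ (by norm_num) hd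
        _ ≤ _ := by gcongr; linarith [(dyadicHeight h).cast_nonneg (α := ℝ)]
  rw [approxRate, mul_one_div, div_le_one (by linarith)]
  linarith

theorem exists_mul_ne_mul_of_gcd_eq_one {d : ℕ} {h h' : Fin d → ℕ} (hh : Finset.univ.gcd h = 1)
    (hh' : Finset.univ.gcd h' = 1) (hne : h ≠ h') : ∃ i j, h i * h' j ≠ h j * h' i := by
  by_contra! hcon
  refine hne (funext fun i => ?_)
  have h1 : Finset.univ.gcd (fun j => h i * h' j) = h i := by
    rw [Finset.gcd_mul_left, hh']; simp
  have h2 : Finset.univ.gcd (fun j => h j * h' i) = h' i := by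
    rw [Finset.gcd_mul_right, hh]; simp
  rw [← h1, ← h2]
  exact congrArg _ (funext (hcon i))

theorem ae_infinite_norm_le_approxRate_of_two_le {d : ℕ} (hd : 2 ≤ d) :
    ∀ᵐ x : Fin d → UnitAddCircle,
      {h : Fin d → ℕ | (∀ i, 1 ≤ h i) ∧ ‖∑ i, h i • x i‖ ≤ approxRate h}.Infinite := by
  classical
  let P := {h : Fin d → ℕ // (∀ i, 1 ≤ h i) ∧ Finset.univ.gcd h = 1}
  let E : P → Set (Fin d → UnitAddCircle) := fun h => {x | ‖∑ i, h.1 i • x i‖ ≤ approxRate h.1}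
  have hE : ∀ h, MeasurableSet (E h) := fun h =>
    (isClosed_le (by fun_prop) continuous_const).measurableSet
  have hμ : ∀ h, volume.real (E h) = 2 * approxRate h.1 := fun h =>
    measureReal_norm_sum_nsmul_le (i := ⟨0, by omega⟩) (by have := h.2.1 ⟨0, by omega⟩; omega)
      (approxRate_pos _).le (two_mul_approxRate_le_one hd _)
  have hμμ : ∀ h h', h ≠ h' →
      volume.real (E h ∩ E h') = volume.real (E h) * volume.real (E h') := by
    intro h h' hne
    obtain ⟨i, j, hij⟩ := exists_mul_ne_mul_of_gcd_eq_one h.2.2 h'.2.2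
      (fun H => hne (Subtype.ext H))
    rw [hμ, hμ]
    exact measureReal_inter_norm_sum_nsmul_le hij (approxRate_pos _).le
      (two_mul_approxRate_le_one hd _) (approxRate_pos _).le (two_mul_approxRate_le_one hd _)
  have hnot : ¬ Summable fun h => volume.real (E h) := by
    simp only [hμ]
    rw [summable_mul_left_iff two_ne_zero]
    exact not_summable_approxRate_primitive hd
  have hKS := le_measureReal_infinite_of_quasiIndep volume E hE one_pos zero_le_one
    (fun m L => by
      obtain ⟨F, hF, hL⟩ := exists_disjoint_le_sum_of_not_summable
        (fun h => measureReal_nonneg) hnot m L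
      refine ⟨F, hF, hL, ?_⟩
      rw [sq, Finset.sum_mul_sum, one_mul, one_mul, ← Finset.sum_add_distrib]
      refine Finset.sum_le_sum fun h hh => ?_
      calc ∑ h' ∈ F, volume.real (E h ∩ E h')
          ≤ ∑ h' ∈ F, (volume.real (E h) * volume.real (E h') +
            if h = h' then volume.real (E h) else 0) := by
            refine Finset.sum_le_sum fun h' _ => ?_
            split_ifs with heq
            · subst heq
              rw [Set.inter_self]
              exact le_add_of_nonneg_left (mul_nonneg measureReal_nonneg measureReal_nonneg)
            · rw [hμμ h h' heq, add_zero]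
        _ = _ := by rw [Finset.sum_add_distrib, Finset.sum_ite_eq, if_pos hh])
  have hone : volume {x | {h | x ∈ E h}.Infinite} = 1 := by
    refine le_antisymm prob_le_one ?_
    rw [div_one, measureReal_def] at hKS
    simpa using (ENNReal.ofReal_le_iff_le_toReal (measure_ne_top _ _)).2 hKS
  filter_upwards [(mem_ae_iff_prob_eq_one (measurableSet_setOf_infinite_mem hE)).2 hone] with x hx
  refine (Set.Infinite.image Subtype.val_injective.injOn hx).mono ?_
  rintro _ ⟨h, hh, rfl⟩
  exact ⟨h.2.1, hh⟩

/-- The reduced fractions `a / q` in `[0, 1)` with `2 ^ k ≤ q < 2 ^ (k + 1)`, as pairs `⟨q, a⟩`. -/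
def fareyBlock (k : ℕ) : Finset (Σ _ : ℕ, ℕ) :=
  (Finset.Ico (2 ^ k) (2 ^ (k + 1))).sigma fun q => {a ∈ Finset.range q | q.Coprime a}

/-- The point of the circle represented by the fraction `⟨q, a⟩`. -/
noncomputable def fareyPoint (p : Σ _ : ℕ, ℕ) : UnitAddCircle := ((p.2 / p.1 : ℝ) : UnitAddCircle)

theorem mem_fareyBlock {k : ℕ} {p : Σ _ : ℕ, ℕ} :
    p ∈ fareyBlock k ↔ (2 ^ k ≤ p.1 ∧ p.1 < 2 ^ (k + 1)) ∧ p.2 < p.1 ∧ p.1.Coprime p.2 := by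
  simp [fareyBlock]

theorem log_eq_of_mem_fareyBlock {k : ℕ} {p : Σ _ : ℕ, ℕ} (hp : p ∈ fareyBlock k) :
    Nat.log 2 p.1 = k :=
  Nat.log_eq_of_pow_le_of_lt_pow (mem_fareyBlock.1 hp).1.1 (mem_fareyBlock.1 hp).1.2

theorem four_pow_div_six_le_card_fareyBlock (k : ℕ) : (4 : ℝ) ^ k / 6 ≤ (fareyBlock k).card := by
  rw [fareyBlock, Finset.card_sigma]
  exact four_pow_div_six_le_sum_totient k

theorem card_fareyBlock_le (k : ℕ) : ((fareyBlock k).card : ℝ) ≤ 2 * 4 ^ k := by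
  have : (fareyBlock k).card ≤ 2 ^ k * 2 ^ (k + 1) := by
    rw [fareyBlock, Finset.card_sigma]
    refine (Finset.sum_le_card_nsmul _ _ (2 ^ (k + 1)) fun q hq => ?_).trans ?_
    · exact (Finset.card_filter_le _ _).trans
        (by rw [Finset.card_range]; exact (Finset.mem_Ico.1 hq).2.le)
    · rw [Nat.card_Ico, pow_succ, mul_two, Nat.add_sub_cancel, smul_eq_mul]
  calc ((fareyBlock k).card : ℝ) ≤ ((2 ^ k * 2 ^ (k + 1) : ℕ) : ℝ) := by exact_mod_cast this
    _ = 2 * 4 ^ k := by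
      push_cast
      rw [show (4 : ℝ) = 2 * 2 by norm_num, mul_pow]; ring

theorem lt_norm_fareyPoint_sub {k : ℕ} {p p' : Σ _ : ℕ, ℕ} (hp : p ∈ fareyBlock k)
    (hp' : p' ∈ fareyBlock k) (hne : p ≠ p') :
    1 / (4 : ℝ) ^ (k + 1) < ‖fareyPoint p - fareyPoint p'‖ := by
  obtain ⟨q, a⟩ := p
  obtain ⟨q', a'⟩ := p'
  obtain ⟨⟨hq1, hq2⟩, haq, hco⟩ := mem_fareyBlock.1 hp
  obtain ⟨⟨hq1', hq2'⟩, haq', hco'⟩ := mem_fareyBlock.1 hp'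
  dsimp only at *
  have hq0 : (0 : ℝ) < q := by exact_mod_cast (by omega : 0 < q)
  have hq0' : (0 : ℝ) < q' := by exact_mod_cast (by omega : 0 < q')
  rw [fareyPoint, fareyPoint, ← AddCircle.coe_sub, UnitAddCircle.norm_eq]
  set n := round ((a / q : ℝ) - a' / q')
  have hnum : (a * q' - a' * q - n * q * q' : ℤ) ≠ 0 := by
    intro h0
    have h1 : (q : ℤ) ∣ a * q' := ⟨a' + n * q', by linarith⟩
    have h2 : (q' : ℤ) ∣ a' * q := ⟨a - n * q, by linarith⟩
    have h3 : q ∣ q' := hco.dvd_of_dvd_mul_left (by exact_mod_cast h1)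
    have h4 : q' ∣ q := hco'.dvd_of_dvd_mul_left (by exact_mod_cast h2)
    obtain rfl := Nat.dvd_antisymm h3 h4
    have h5 : (q : ℤ) ∣ a - a' := ⟨n, by
      have : (q : ℤ) * (a - a' - q * n) = 0 := by linarith
      rcases mul_eq_zero.1 this with h | h
      · omega
      · linarith⟩
    have h6 := Int.eq_zero_of_abs_lt_dvd h5 (by rw [abs_lt]; omega)
    apply hne
    rw [show a = a' by omega]
  have hnum' : (1 : ℝ) ≤ |(a * q' - a' * q - n * q * q' : ℝ)| := by
    exact_mod_cast Int.one_le_abs hnum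
  have heq : (a / q : ℝ) - a' / q' - n = (a * q' - a' * q - n * q * q' : ℝ) / (q * q') := by
    field_simp
  rw [heq, abs_div, abs_of_pos (by positivity : (0 : ℝ) < q * q')]
  refine lt_of_lt_of_le ?_ (div_le_div_of_nonneg_right hnum' (by positivity))
  refine one_div_lt_one_div_of_lt (by positivity) ?_
  have : q * q' < 4 ^ (k + 1) := by
    calc q * q' < 2 ^ (k + 1) * 2 ^ (k + 1) := Nat.mul_lt_mul'' hq2 hq2'
      _ = 4 ^ (k + 1) := by rw [← mul_pow]; norm_num
  exact_mod_cast this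

theorem measureReal_closedBall_le (x : UnitAddCircle) {r : ℝ} (hr : 0 ≤ r) :
    volume.real (Metric.closedBall x r) ≤ 2 * r := by
  rw [measureReal_def, AddCircle.volume_closedBall, ENNReal.toReal_ofReal (by positivity)]
  exact min_le_right _ _

theorem measureReal_closedBall_eq (x : UnitAddCircle) {r : ℝ} (hr : 0 ≤ r) (hr' : 2 * r ≤ 1) :
    volume.real (Metric.closedBall x r) = 2 * r := by
  rw [measureReal_def, AddCircle.volume_closedBall, ENNReal.toReal_ofReal (by positivity),
    min_eq_right hr']

theorem card_mul_le_of_separated {ι : Type*} {T : Finset ι} {c : ι → UnitAddCircle} {s r : ℝ}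
    (hs : 0 ≤ s) (hs' : s ≤ 1) (hr : 0 ≤ r) (x : UnitAddCircle)
    (hsep : ∀ i ∈ T, ∀ j ∈ T, i ≠ j → s < ‖c i - c j‖) (hT : ∀ i ∈ T, ‖x - c i‖ ≤ r) :
    T.card * s ≤ 2 * r + s := by
  have hdisj : Set.PairwiseDisjoint (T : Set ι) fun i => Metric.closedBall (c i) (s / 2) := by
    intro i hi j hj hij
    refine Metric.closedBall_disjoint_closedBall ?_
    rw [dist_eq_norm]
    linarith [hsep i hi j hj hij]
  have hsub : (⋃ i ∈ T, Metric.closedBall (c i) (s / 2)) ⊆ Metric.closedBall x (r + s / 2) := by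
    refine Set.iUnion₂_subset fun i hi => Metric.closedBall_subset_closedBall' ?_
    rw [dist_comm, dist_eq_norm]
    linarith [hT i hi]
  have h := measureReal_mono (μ := volume) hsub
  rw [measureReal_biUnion_finset hdisj fun i _ => Metric.isClosed_closedBall.measurableSet,
    Finset.sum_congr rfl fun i _ => measureReal_closedBall_eq (c i) (by positivity)
      (by linarith), Finset.sum_const, nsmul_eq_mul] at h
  have h' := h.trans (measureReal_closedBall_le x (by positivity))
  linarith

theorem sum_fareyBlock_measureReal_inter_le (k : ℕ) (x : UnitAddCircle) {r r' : ℝ} (hr : 0 ≤ r)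
    (hr' : 0 ≤ r') :
    ∑ p ∈ fareyBlock k,
      volume.real (Metric.closedBall x r' ∩ Metric.closedBall (fareyPoint p) r) ≤
      2 * r * (1 + 2 * (r' + r) * 4 ^ (k + 1)) := by
  classical
  set T := {p ∈ fareyBlock k | ‖x - fareyPoint p‖ ≤ r' + r} with hT
  have hterm : ∀ p ∈ fareyBlock k,
      volume.real (Metric.closedBall x r' ∩ Metric.closedBall (fareyPoint p) r) ≤
        if ‖x - fareyPoint p‖ ≤ r' + r then 2 * r else 0 := by
    intro p _
    split_ifs with h
    · exact (measureReal_mono Set.inter_subset_right).trans (measureReal_closedBall_le _ hr)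
    · rw [(Metric.closedBall_disjoint_closedBall
        (by rw [dist_eq_norm]; exact not_le.1 h)).inter_eq]
      simp
  have hcard := card_mul_le_of_separated (T := T) (c := fareyPoint) (s := 1 / (4 : ℝ) ^ (k + 1))
    (r := r' + r) (by positivity)
    (by rw [div_le_one (by positivity)]; exact one_le_pow₀ (by norm_num)) (by positivity) x
    (fun p hp p' hp' hne => lt_norm_fareyPoint_sub (Finset.mem_filter.1 hp).1
      (Finset.mem_filter.1 hp').1 hne) fun p hp => (Finset.mem_filter.1 hp).2
  have hcard' : (T.card : ℝ) ≤ 1 + 2 * (r' + r) * 4 ^ (k + 1) := by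
    have h4 : (0 : ℝ) < 4 ^ (k + 1) := by positivity
    have := mul_le_mul_of_nonneg_right hcard h4.le
    rw [mul_assoc, one_div, inv_mul_cancel₀ h4.ne', add_mul, inv_mul_cancel₀ h4.ne'] at this
    linarith
  calc _ ≤ ∑ p ∈ fareyBlock k, if ‖x - fareyPoint p‖ ≤ r' + r then 2 * r else 0 :=
        Finset.sum_le_sum hterm
    _ = T.card * (2 * r) := by rw [← Finset.sum_filter, Finset.sum_const, nsmul_eq_mul]
    _ ≤ _ := by rw [mul_comm]; gcongr

theorem not_summable_one_div_add_two_mul_log :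
    ¬ Summable fun k : ℕ => 1 / (((k : ℝ) + 2) * log ((k : ℝ) + 2)) := by
  have hlog : ∀ k : ℕ, 0 < log ((k : ℝ) + 2) := fun k => by
    linarith [half_lt_log_add_two k]
  rw [← summable_condensed_iff_of_nonneg (fun k => by have := hlog k; positivity)
    fun m n _ hmn => by
      have := hlog m
      have hmn' : (m : ℝ) ≤ n := by exact_mod_cast hmn
      gcongr]
  intro hs
  have hle : ∀ k : ℕ, 1 / 6 * (1 / ((k : ℝ) + 1)) ≤
      2 ^ k * (1 / ((((2 ^ k : ℕ) : ℝ) + 2) * log (((2 ^ k : ℕ) : ℝ) + 2))) := by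
    intro k
    have h1 : (1 : ℝ) ≤ 2 ^ k := one_le_pow₀ (by norm_num)
    have h2 : log (((2 ^ k : ℕ) : ℝ) + 2) ≤ 2 * (k + 1) := by
      push_cast
      calc log ((2 : ℝ) ^ k + 2) ≤ log (2 ^ (k + 2)) :=
            log_le_log (by positivity) (by rw [pow_add]; linarith)
        _ = (k + 2) * log 2 := by rw [log_pow]; push_cast; rfl
        _ ≤ (k + 2) * 1 := by gcongr; linarith [log_two_lt_d9]
        _ ≤ _ := by linarith [k.cast_nonneg (α := ℝ)]
    have h3 := hlog (2 ^ k)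
    calc 1 / 6 * (1 / ((k : ℝ) + 1)) = 2 ^ k * (1 / ((3 * 2 ^ k) * (2 * (k + 1)))) := by
          field_simp; norm_num
      _ ≤ _ := by
          gcongr
          push_cast
          linarith
  have h1 : Summable fun k : ℕ => 1 / 6 * (1 / ((k : ℝ) + 1)) :=
    Summable.of_nonneg_of_le (fun k => by positivity) hle hs
  have h2 : Summable fun k : ℕ => 1 / ((k : ℝ)) := by
    rw [← summable_nat_add_iff 1]
    simpa using (summable_mul_left_iff (by norm_num)).1 h1
  exact Real.not_summable_one_div_natCast h2

/-- The critical distance to fractions with denominator in `[2 ^ k, 2 ^ (k + 1))`. -/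
noncomputable def fareyRadius (k : ℕ) : ℝ := 1 / (4 * 4 ^ k * (((k : ℝ) + 2) * log ((k : ℝ) + 2)))

theorem fareyRadius_pos (k : ℕ) : 0 < fareyRadius k := by
  have := half_lt_log_add_two k
  have : 0 < log ((k : ℝ) + 2) := by linarith
  unfold fareyRadius
  positivity

theorem antitone_fareyRadius : Antitone fareyRadius := by
  intro j k hjk
  have := half_lt_log_add_two j
  have hl : 0 < log ((j : ℝ) + 2) := by linarith
  have hjk' : (j : ℝ) ≤ k := by exact_mod_cast hjk
  unfold fareyRadius
  have h4 : (1 : ℝ) ≤ 4 := by norm_num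
  gcongr

theorem fareyRadius_le (k : ℕ) : fareyRadius k ≤ 1 / (4 * 4 ^ k) := by
  have := half_lt_log_add_two k
  have h1 : 1 ≤ ((k : ℝ) + 2) * log ((k : ℝ) + 2) := by nlinarith [k.cast_nonneg (α := ℝ)]
  unfold fareyRadius
  refine one_div_le_one_div_of_le (by positivity) ?_
  exact le_mul_of_one_le_right (by positivity) h1

theorem two_mul_fareyRadius_le_one (k : ℕ) : 2 * fareyRadius k ≤ 1 := by
  have h1 : (1 : ℝ) / (4 * 4 ^ k) ≤ 1 / 4 :=
    one_div_le_one_div_of_le (by norm_num)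
      (le_mul_of_one_le_right (by norm_num) (one_le_pow₀ (by norm_num)))
  linarith [fareyRadius_le k]

theorem not_summable_four_pow_mul_fareyRadius :
    ¬ Summable fun k : ℕ => 4 ^ k * fareyRadius k := by
  intro h
  refine not_summable_one_div_add_two_mul_log ((h.mul_left 4).congr fun k => ?_)
  unfold fareyRadius
  field_simp

/-- The arc of radius `fareyRadius` around a reduced fraction in `[0, 1)`. -/
def fareyArc (p : Σ _ : ℕ, ℕ) : Set UnitAddCircle :=
  {x | (p.2 < p.1 ∧ p.1.Coprime p.2) ∧ ‖x - fareyPoint p‖ ≤ fareyRadius (Nat.log 2 p.1)}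

theorem fareyArc_eq_closedBall {k : ℕ} {p : Σ _ : ℕ, ℕ} (hp : p ∈ fareyBlock k) :
    fareyArc p = Metric.closedBall (fareyPoint p) (fareyRadius k) := by
  ext x
  rw [fareyArc, Set.mem_ofPred_eq, log_eq_of_mem_fareyBlock hp, Metric.mem_closedBall,
    dist_eq_norm, and_iff_right (mem_fareyBlock.1 hp).2]

theorem measurableSet_fareyArc (p : Σ _ : ℕ, ℕ) : MeasurableSet (fareyArc p) :=
  (MeasurableSet.const _).inter <|
    measurableSet_le (f := fun x => ‖x - fareyPoint p‖) (by fun_prop) measurable_const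

theorem sum_fareyBlock_inter_le_of_le {j k : ℕ} (hjk : j ≤ k) :
    ∑ p ∈ fareyBlock j, ∑ p' ∈ fareyBlock k, volume.real (fareyArc p ∩ fareyArc p') ≤
      4 * 4 ^ j * fareyRadius k + 64 * ((4 ^ j * fareyRadius j) * (4 ^ k * fareyRadius k)) := by
  have hj := fareyRadius_pos j
  have hk := fareyRadius_pos k
  have hle := antitone_fareyRadius hjk
  calc _ ≤ ∑ p ∈ fareyBlock j,
        2 * fareyRadius k * (1 + 2 * (fareyRadius j + fareyRadius j) * 4 ^ (k + 1)) := by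
        refine Finset.sum_le_sum fun p hp => ?_
        rw [fareyArc_eq_closedBall hp, Finset.sum_congr rfl fun p' hp' => by
          rw [fareyArc_eq_closedBall hp']]
        refine (sum_fareyBlock_measureReal_inter_le k _ hk.le hj.le).trans ?_
        gcongr
    _ ≤ 2 * 4 ^ j *
        (2 * fareyRadius k * (1 + 2 * (fareyRadius j + fareyRadius j) * 4 ^ (k + 1))) := by
        rw [Finset.sum_const, nsmul_eq_mul]
        gcongr
        exact card_fareyBlock_le j
    _ = _ := by ring

theorem sum_fareyBlock_inter_le (j k : ℕ) :
    ∑ p ∈ fareyBlock j, ∑ p' ∈ fareyBlock k, volume.real (fareyArc p ∩ fareyArc p') ≤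
      (if j ≤ k then 4 * 4 ^ j * fareyRadius k else 0) +
      (if k ≤ j then 4 * 4 ^ k * fareyRadius j else 0) +
      64 * ((4 ^ j * fareyRadius j) * (4 ^ k * fareyRadius k)) := by
  have hj := fareyRadius_pos j
  have hk := fareyRadius_pos k
  rcases le_total j k with h | h
  · refine (sum_fareyBlock_inter_le_of_le h).trans ?_
    rw [if_pos h]
    have : 0 ≤ if k ≤ j then 4 * 4 ^ k * fareyRadius j else 0 := by split_ifs <;> positivity
    linarith
  · have h0 : 0 ≤ if j ≤ k then 4 * 4 ^ j * fareyRadius k else 0 := by split_ifs <;> positivity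
    have hsymm : ∑ p ∈ fareyBlock j, ∑ p' ∈ fareyBlock k, volume.real (fareyArc p ∩ fareyArc p') =
        ∑ p ∈ fareyBlock k, ∑ p' ∈ fareyBlock j, volume.real (fareyArc p ∩ fareyArc p') := by
      rw [Finset.sum_comm]
      exact Finset.sum_congr rfl fun p _ => Finset.sum_congr rfl fun p' _ => by
        rw [Set.inter_comm]
    rw [hsymm, if_pos h]
    linarith [sum_fareyBlock_inter_le_of_le h]

theorem sum_sum_four_pow_le (G : Finset ℕ) :
    ∑ k ∈ G, ∑ j ∈ G, (if j ≤ k then 4 * 4 ^ j * fareyRadius k else 0) ≤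
      8 * ∑ k ∈ G, 4 ^ k * fareyRadius k := by
  rw [Finset.mul_sum]
  refine Finset.sum_le_sum fun k _ => ?_
  have hk := fareyRadius_pos k
  calc ∑ j ∈ G, (if j ≤ k then 4 * 4 ^ j * fareyRadius k else 0)
      = ∑ j ∈ G with j ≤ k, 4 * 4 ^ j * fareyRadius k := by rw [Finset.sum_filter]
    _ ≤ ∑ j ∈ Finset.range (k + 1), 4 * 4 ^ j * fareyRadius k := by
        refine Finset.sum_le_sum_of_subset_of_nonneg (fun j hj => ?_) fun j _ _ => by positivity
        exact Finset.mem_range_succ_iff.2 (Finset.mem_filter.1 hj).2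
    _ = 4 * fareyRadius k * ∑ j ∈ Finset.range (k + 1), (4 : ℝ) ^ j := by
        rw [Finset.mul_sum]
        exact Finset.sum_congr rfl fun j _ => by ring
    _ ≤ 4 * fareyRadius k * (2 * 4 ^ k) := by
        rw [geom_sum_eq (by norm_num), pow_succ]
        gcongr
        have : (0 : ℝ) < 4 ^ k := by positivity
        linarith
    _ = _ := by ring

theorem exists_quasiIndep_fareyArc (m : Finset (Σ _ : ℕ, ℕ)) (L : ℝ) :
    ∃ F : Finset (Σ _ : ℕ, ℕ), Disjoint F m ∧ L ≤ ∑ p ∈ F, volume.real (fareyArc p) ∧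
      ∑ p ∈ F, ∑ p' ∈ F, volume.real (fareyArc p ∩ fareyArc p') ≤
        576 * (∑ p ∈ F, volume.real (fareyArc p)) ^ 2 +
          48 * ∑ p ∈ F, volume.real (fareyArc p) := by
  classical
  obtain ⟨G, hG, hL⟩ := exists_disjoint_le_sum_of_not_summable
    (fun k => mul_nonneg (by positivity) (fareyRadius_pos k).le)
    not_summable_four_pow_mul_fareyRadius (m.image fun p => Nat.log 2 p.1) (3 * max L 0)
  set B := ∑ k ∈ G, 4 ^ k * fareyRadius k with hB
  have hB0 : 0 ≤ B := le_trans (by positivity) hL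
  have hsum : ∀ f : (Σ _ : ℕ, ℕ) → ℝ,
      ∑ p ∈ G.biUnion fareyBlock, f p = ∑ k ∈ G, ∑ p ∈ fareyBlock k, f p := by
    refine fun f => Finset.sum_biUnion fun j _ k _ hjk => ?_
    exact Finset.disjoint_left.2 fun p hp hp' =>
      hjk ((log_eq_of_mem_fareyBlock hp).symm.trans (log_eq_of_mem_fareyBlock hp'))
  have hS : B / 3 ≤ ∑ p ∈ G.biUnion fareyBlock, volume.real (fareyArc p) := by
    rw [hsum, hB, Finset.sum_div]
    refine Finset.sum_le_sum fun k _ => ?_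
    have hk := fareyRadius_pos k
    rw [Finset.sum_congr rfl fun p hp => by
      rw [fareyArc_eq_closedBall hp,
        measureReal_closedBall_eq _ hk.le (two_mul_fareyRadius_le_one k)],
      Finset.sum_const, nsmul_eq_mul]
    have := mul_le_mul_of_nonneg_right (four_pow_div_six_le_card_fareyBlock k)
      (by positivity : 0 ≤ 2 * fareyRadius k)
    linarith
  refine ⟨G.biUnion fareyBlock, ?_, ?_, ?_⟩
  · refine Finset.disjoint_left.2 fun p hp hpm => ?_
    obtain ⟨k, hk, hpk⟩ := Finset.mem_biUnion.1 hp
    refine Finset.disjoint_left.1 hG hk ?_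
    rw [← log_eq_of_mem_fareyBlock hpk]
    exact Finset.mem_image_of_mem _ hpm
  · linarith [le_max_left L 0]
  · have hdouble : ∑ p ∈ G.biUnion fareyBlock, ∑ p' ∈ G.biUnion fareyBlock,
        volume.real (fareyArc p ∩ fareyArc p') ≤ 16 * B + 64 * B ^ 2 := by
      calc _ = ∑ j ∈ G, ∑ k ∈ G, ∑ p ∈ fareyBlock j, ∑ p' ∈ fareyBlock k,
            volume.real (fareyArc p ∩ fareyArc p') := by
            rw [hsum]
            exact Finset.sum_congr rfl fun j _ =>
              (Finset.sum_congr rfl fun p _ => hsum _).trans Finset.sum_comm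
        _ ≤ ∑ j ∈ G, ∑ k ∈ G, ((if j ≤ k then 4 * 4 ^ j * fareyRadius k else 0) +
            (if k ≤ j then 4 * 4 ^ k * fareyRadius j else 0) +
            64 * ((4 ^ j * fareyRadius j) * (4 ^ k * fareyRadius k))) :=
            Finset.sum_le_sum fun j _ => Finset.sum_le_sum fun k _ => sum_fareyBlock_inter_le j k
        _ ≤ 8 * B + 8 * B + 64 * (B * B) := by
            simp only [Finset.sum_add_distrib, ← Finset.mul_sum]
            rw [← Finset.sum_mul]
            gcongr
            · rw [Finset.sum_comm]
              exact sum_sum_four_pow_le G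
            · exact sum_sum_four_pow_le G
        _ = _ := by ring
    nlinarith

theorem one_div_le_measureReal_infinite_fareyArc :
    1 / 576 ≤ volume.real {x : UnitAddCircle | {p | x ∈ fareyArc p}.Infinite} :=
  le_measureReal_infinite_of_quasiIndep volume fareyArc measurableSet_fareyArc (by norm_num)
    (by norm_num : (0 : ℝ) ≤ 48) exists_quasiIndep_fareyArc

theorem ae_mem_addWellApproximable :
    ∀ᵐ x : UnitAddCircle,
      x ∈ addWellApproximable UnitAddCircle fun n => 2 * fareyRadius (Nat.log 2 n) := by
  have htends : Filter.Tendsto (fun n => 2 * fareyRadius (Nat.log 2 n)) Filter.atTop (nhds 0) := by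
    have h1 : Filter.Tendsto fareyRadius Filter.atTop (nhds 0) := by
      refine squeeze_zero (fun k => (fareyRadius_pos k).le) (fun k => (fareyRadius_le k).trans ?_)
        (tendsto_pow_atTop_nhds_zero_of_lt_one (r := 1 / 4) (by norm_num) (by norm_num))
      rw [one_div_pow]
      refine one_div_le_one_div_of_le (by positivity) ?_
      exact le_mul_of_one_le_left (by positivity) (by norm_num)
    have h2 : Filter.Tendsto (Nat.log 2) Filter.atTop Filter.atTop :=
      Filter.tendsto_atTop_atTop.2 fun k => ⟨2 ^ k, fun n hn =>
        Nat.le_log_of_pow_le one_lt_two hn⟩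
    simpa using (h1.comp h2).const_mul 2
  refine (AddCircle.addWellApproximable_ae_empty_or_univ _ htends).resolve_left fun hemp => ?_
  have hsub : {x : UnitAddCircle | {p | x ∈ fareyArc p}.Infinite} ⊆
      addWellApproximable UnitAddCircle fun n => 2 * fareyRadius (Nat.log 2 n) := by
    intro x hx
    rw [UnitAddCircle.mem_addWellApproximable_iff]
    intro hfin
    refine hx ((hfin.toFinset.sigma fun q => Finset.range q).finite_toSet.subset fun p hp => ?_)
    simp only [Finset.coe_sigma, Set.mem_sigma_iff, Finset.mem_coe, Set.Finite.mem_toFinset,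
      Finset.mem_range]
    refine ⟨⟨p.2, hp.1.1, hp.1.2.symm, hp.2.trans_lt ?_⟩, hp.1.1⟩
    linarith [fareyRadius_pos (Nat.log 2 p.1)]
  have hnull : volume {x : UnitAddCircle | {p | x ∈ fareyArc p}.Infinite} = 0 :=
    measure_mono_null hsub (by simpa [ae_iff] using hemp)
  have := one_div_le_measureReal_infinite_fareyArc
  rw [measureReal_def, hnull] at this
  norm_num at this

theorem ae_infinite_norm_le_approxRate_one :
    ∀ᵐ x : Fin 1 → UnitAddCircle,
      {h : Fin 1 → ℕ | (∀ i, 1 ≤ h i) ∧ ‖∑ i, h i • x i‖ ≤ approxRate h}.Infinite := by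
  have hev : MeasurePreserving (fun x : Fin 1 → UnitAddCircle => x 0) volume volume :=
    measurePreserving_eval (fun _ => (volume : Measure UnitAddCircle)) 0
  filter_upwards [hev.quasiMeasurePreserving.ae ae_mem_addWellApproximable] with x hx
  rw [UnitAddCircle.mem_addWellApproximable_iff] at hx
  have hinj : Function.Injective fun (q : ℕ) (_ : Fin 1) => q := fun q q' h => congrFun h 0
  refine (hx.image hinj.injOn).mono ?_
  rintro _ ⟨q, ⟨a, haq, -, hle⟩, rfl⟩
  have hq : (0 : ℝ) < q := by exact_mod_cast (by omega : 0 < q)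
  refine ⟨fun _ => Nat.one_le_of_lt haq, ?_⟩
  have hcenter : q • ((a / q : ℝ) : UnitAddCircle) = 0 := by
    rw [← AddCircle.coe_nsmul, nsmul_eq_mul, mul_div_cancel₀ _ hq.ne']
    have : ((a : ℝ) : UnitAddCircle) = a • ((1 : ℝ) : UnitAddCircle) := by
      rw [← AddCircle.coe_nsmul, nsmul_eq_mul, mul_one]
    rw [this, AddCircle.coe_period, smul_zero]
  have hq2 : (q : ℝ) ≤ 2 * 2 ^ Nat.log 2 q := by
    rw [← pow_succ']
    exact_mod_cast (Nat.lt_pow_succ_log_self (by norm_num) q).le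
  have hlog := half_lt_log_add_two (Nat.log 2 q)
  have hlog0 : 0 < log ((Nat.log 2 q : ℝ) + 2) := by linarith
  calc ‖∑ i : Fin 1, q • x i‖ = ‖q • (x 0 - ((a / q : ℝ) : UnitAddCircle))‖ := by
        rw [smul_sub, hcenter, sub_zero]; simp
    _ ≤ q * ‖x 0 - ((a / q : ℝ) : UnitAddCircle)‖ := norm_nsmul_le
    _ ≤ 2 * 2 ^ Nat.log 2 q * (2 * fareyRadius (Nat.log 2 q)) := by gcongr
    _ = _ := by
      rw [approxRate, fareyRadius, dyadicHeight, show (4 : ℝ) ^ Nat.log 2 q =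
        2 ^ Nat.log 2 q * 2 ^ Nat.log 2 q by rw [← mul_pow]; norm_num]
      simp only [Finset.univ_unique, Finset.sum_singleton, pow_one]
      field_simp
      norm_num

theorem ae_infinite_norm_le_approxRate {d : ℕ} (hd : 1 ≤ d) :
    ∀ᵐ x : Fin d → UnitAddCircle,
      {h : Fin d → ℕ | (∀ i, 1 ≤ h i) ∧ ‖∑ i, h i • x i‖ ≤ approxRate h}.Infinite := by
  rcases hd.eq_or_lt with rfl | hd
  · exact ae_infinite_norm_le_approxRate_one
  · exact ae_infinite_norm_le_approxRate_of_two_le hd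

theorem stmt1 (d : ℕ) (hd : 1 ≤ d) :
    ∀ᵐ α ∂((volume : Measure (Fin d → ℝ)).restrict
        (Set.univ.pi fun _ => Set.Ico (0 : ℝ) 1)),
      ∃ C > 0, ∀ m : ℕ, ∃ N : ℕ, m ≤ N ∧
        C * Real.log N ^ d * Real.log (Real.log N) / N
          ≤ disc (fun n i => Int.fract (n * α i)) N := by
  have hmk : MeasurePreserving ((↑) : ℝ → UnitAddCircle)
      (volume.restrict (Set.Ico (0 : ℝ) 1)) volume := by
    rw [Measure.restrict_congr_set Ico_ae_eq_Ioc]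
    simpa using UnitAddCircle.measurePreserving_mk 0
  have hpi := measurePreserving_pi (ι := Fin d) (fun _ => volume.restrict (Set.Ico (0 : ℝ) 1))
    (fun _ => (volume : Measure UnitAddCircle)) fun _ => hmk
  rw [← Measure.restrict_pi_pi] at hpi
  filter_upwards [hpi.quasiMeasurePreserving.ae (ae_infinite_norm_le_approxRate hd)] with α hα
  refine exists_disc_lower_bound hd α (hα.mono fun h hh => ⟨hh.1, ?_⟩)
  convert hh.2 using 2
  simp only [← AddCircle.coe_nsmul, nsmul_eq_mul]
  exact map_sum (QuotientAddGroup.mk' (AddSubgroup.zmultiples (1 : ℝ))) _ _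
end

section
/- Let d ≥ 1, let q be a prime, and let ε > 0. Then for μ_d-almost all d-tuples (C_1,…,C_d) of ℕ×ℕ matrices over Z_q, where μ_d is the product probability measure under which all matrix entries are independent and uniformly distributed on Z_q, there exists a constant C > 0 such that the discrepancy D_N of the digital sequence S(C_1,…,C_d) satisfies D_N ≤ C · (log N)^d (log log N)^{2+ε} / N for all N ≥ 3. -/
open MeasureTheory Real

instance (n : ℕ) : MeasurableSpace (ZMod n) := ⊤

/-- The digital sequence over `ZMod q` generated by the `ℕ × ℕ` matrices `C j`:
the `j`-th coordinate of the `n`-th point is `∑_{k≥0} y_{j,k} / q^(k+1)`, where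
`y_{j,k} ∈ {0,…,q-1}` is the value of the `k`-th entry of `C j` applied to the
vector of base-`q` digits of `n`. -/
noncomputable def digitalSeq {q : ℕ} (d : ℕ) (C : Fin d → ℕ → ℕ → ZMod q)
    (n : ℕ) : Fin d → ℝ :=
  fun j => ∑' k : ℕ,
    ((∑ i ∈ Finset.range (Nat.digits q n).length,
        C j k i * ((Nat.digits q n).getD i 0 : ZMod q)).val : ℝ) / (q : ℝ) ^ (k + 1)


lemma AddMonoidHom.card_ker_facts {V W : Type*} [AddCommGroup V] [AddCommGroup W] [Finite V]
    [Finite W] (f : V →+ W) (g : ℕ) (hg : Nat.card V = g * Nat.card W) :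
    g ≤ Nat.card f.ker ∧ (Nat.card f.ker ≠ g → 2 * g ≤ Nat.card f.ker) ∧
      ∀ w, |(Nat.card {v // f v = w} : ℝ) - g| ≤ Nat.card f.ker - g := by
  have h1 : Nat.card f.ker * Nat.card f.range = Nat.card V := by
    rw [← AddSubgroup.index_ker, AddSubgroup.card_mul_index]
  obtain ⟨t, ht⟩ := AddSubgroup.card_addSubgroup_dvd_card f.range
  have hR : 0 < Nat.card f.range := Nat.card_pos
  have hW : 0 < Nat.card W := Nat.card_pos
  have hZ : Nat.card f.ker = g * t := by
    apply Nat.eq_of_mul_eq_mul_right hR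
    rw [h1, hg, ht]; ring
  have ht0 : t ≠ 0 := by rintro rfl; omega
  have hfib : ∀ w ∈ f.range, Nat.card {v // f v = w} = Nat.card f.ker := by
    rintro w ⟨u, rfl⟩
    refine Nat.card_congr ⟨fun v => ⟨v.1 - u, by simp [AddMonoidHom.mem_ker, v.2]⟩,
      fun v => ⟨v.1 + u, by simp [(AddMonoidHom.mem_ker (f := f)).mp v.2]⟩, fun v => by simp, fun v => by simp⟩
  have h2 : t ≠ 1 → 2 * g ≤ g * t := by
    intro h
    have : 2 ≤ t := by omega
    nlinarith
  refine ⟨?_, ?_, ?_⟩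
  · rw [hZ]; exact Nat.le_mul_of_pos_right _ (by omega)
  · intro h
    rw [hZ] at h ⊢
    exact h2 (by rintro rfl; simp at h)
  · intro w
    have hle : (g : ℝ) ≤ g * t := by
      exact_mod_cast Nat.le_mul_of_pos_right _ (by omega)
    by_cases hw : w ∈ f.range
    · rw [hfib w hw, hZ]
      push_cast
      rw [abs_of_nonneg (by linarith)]
    · have ht1 : t ≠ 1 := by
        rintro rfl
        have : f.range = ⊤ := AddSubgroup.eq_top_of_card_eq _ (by simpa using ht.symm)
        exact hw (this ▸ AddSubgroup.mem_top w)
      have he : Nat.card {v // f v = w} = 0 := by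
        have : IsEmpty {v // f v = w} := ⟨fun v => hw ⟨v.1, v.2⟩⟩
        simp
      have h3 : ((2 * g : ℕ) : ℝ) ≤ ((g * t : ℕ) : ℝ) := by exact_mod_cast h2 ht1
      push_cast at h3
      rw [he, hZ]
      push_cast
      rw [abs_of_nonpos (by simp)]
      linarith

/-- The linear system formed by the upper left `k j × m` blocks of the matrices `C j`. -/
def blockMap {d q : ℕ} (C : Fin d → ℕ → ℕ → ZMod q) (m : ℕ) (k : Fin d → ℕ) :
    (Fin m → ZMod q) →+ ((Σ j, Fin (k j)) → ZMod q) where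
  toFun v := fun p => ∑ i : Fin m, C p.1 p.2 i * v i
  map_zero' := by ext; simp
  map_add' v w := by ext; simp [mul_add, Finset.sum_add_distrib]

/-- The excess of the number of solutions of the homogeneous block system over the number
of solutions of a system of full rank. -/
noncomputable def excess {d q : ℕ} (C : Fin d → ℕ → ℕ → ZMod q) (m : ℕ) (k : Fin d → ℕ) : ℕ :=
  Nat.card (blockMap C m k).ker - q ^ (m - ∑ j, k j)

lemma card_domain_eq {d q : ℕ} [NeZero q] {m : ℕ} {k : Fin d → ℕ} (hk : ∑ j, k j ≤ m) :
    Nat.card (Fin m → ZMod q) =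
      q ^ (m - ∑ j, k j) * Nat.card ((Σ j, Fin (k j)) → ZMod q) := by
  simp only [Nat.card_eq_fintype_card, Fintype.card_fun, ZMod.card, Fintype.card_fin,
    Fintype.card_sigma]
  rw [← pow_add, Nat.sub_add_cancel hk]

lemma card_ker_eq_excess_add {d q : ℕ} [NeZero q] (C : Fin d → ℕ → ℕ → ZMod q) {m : ℕ}
    {k : Fin d → ℕ} (hk : ∑ j, k j ≤ m) :
    Nat.card (blockMap C m k).ker = excess C m k + q ^ (m - ∑ j, k j) := by
  have := ((blockMap C m k).card_ker_facts _ (card_domain_eq hk)).1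
  rw [excess]; omega

lemma le_excess {d q : ℕ} [NeZero q] (C : Fin d → ℕ → ℕ → ZMod q) {m : ℕ}
    {k : Fin d → ℕ} (hk : ∑ j, k j ≤ m) (h : excess C m k ≠ 0) :
    q ^ (m - ∑ j, k j) ≤ excess C m k := by
  have h1 := ((blockMap C m k).card_ker_facts _ (card_domain_eq hk)).2.1
  rw [card_ker_eq_excess_add C hk] at h1
  have := h1 (by omega)
  omega

lemma abs_card_fiber_sub_le {d q : ℕ} [NeZero q] (C : Fin d → ℕ → ℕ → ZMod q) {m : ℕ}
    {k : Fin d → ℕ} (hk : ∑ j, k j ≤ m) (w : (Σ j, Fin (k j)) → ZMod q) :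
    |(Nat.card {v // blockMap C m k v = w} : ℝ) - (q : ℝ) ^ (m - ∑ j, k j)| ≤ excess C m k := by
  have h1 := ((blockMap C m k).card_ker_facts _ (card_domain_eq hk)).2.2 w
  rw [card_ker_eq_excess_add C hk] at h1
  push_cast at h1
  linarith

/-- The law of a tuple of matrices with independent entries, uniformly distributed
on `ZMod q`. -/
def IsUniformLaw {d q : ℕ} (μ : Measure (Fin d → ℕ → ℕ → ZMod q)) : Prop :=
  ∀ (s : Finset (Fin d × ℕ × ℕ)) (v : Fin d × ℕ × ℕ → ZMod q),
      μ {C | ∀ p ∈ s, C p.1 p.2.1 p.2.2 = v p} = ((q : ENNReal))⁻¹ ^ s.card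

lemma IsUniformLaw.measure_block_eq {d q : ℕ} {μ : Measure (Fin d → ℕ → ℕ → ZMod q)}
    (hμ : IsUniformLaw μ) (m : ℕ) (k : Fin d → ℕ) (A : (Σ j, Fin (k j)) → Fin m → ZMod q) :
    MeasurableSet {C : Fin d → ℕ → ℕ → ZMod q |
      (fun (p : Σ j, Fin (k j)) (i : Fin m) => C p.1 p.2 i) = A} ∧
      μ {C | (fun (p : Σ j, Fin (k j)) (i : Fin m) => C p.1 p.2 i) = A} =
        (q : ENNReal)⁻¹ ^ ((∑ j, k j) * m) := by
  let e : ((Σ j, Fin (k j)) × Fin m) ↪ Fin d × ℕ × ℕ :=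
    ⟨fun x => (x.1.1, x.1.2, x.2), by
      rintro ⟨⟨j, r⟩, i⟩ ⟨⟨j', r'⟩, i'⟩ h
      simp only [Prod.mk.injEq] at h
      obtain ⟨rfl, h1, h2⟩ := h
      simp [Fin.ext_iff, h1, h2]⟩
  have hset : {C : Fin d → ℕ → ℕ → ZMod q |
      (fun (p : Σ j, Fin (k j)) (i : Fin m) => C p.1 p.2 i) = A} =
      {C | ∀ p ∈ Finset.univ.map e,
        C p.1 p.2.1 p.2.2 = Function.extend e (fun x => A x.1 x.2) 0 p} := by
    ext C
    simp only [Set.mem_ofPred_eq, Finset.mem_map, Finset.mem_univ, true_and,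
      forall_exists_index, forall_apply_eq_imp_iff, e.injective.extend_apply]
    simp only [funext_iff, Prod.forall]
    rfl
  rw [hset]
  constructor
  · have : ∀ p : Fin d × ℕ × ℕ, Measurable fun C : Fin d → ℕ → ℕ → ZMod q => C p.1 p.2.1 p.2.2 :=
      fun p => by fun_prop
    simp only [Set.ofPred_forall]
    refine Finset.measurableSet_biInter _ fun p _ => ?_
    exact this p (t := {x | x = _}) trivial
  · rw [hμ, Finset.card_map]
    simp [Fintype.card_sigma]

lemma card_matrix_mulVec_eq_zero {q : ℕ} [Fact q.Prime] {ι : Type*} [Fintype ι] {m : ℕ}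
    {v : Fin m → ZMod q} (hv : v ≠ 0) :
    Nat.card {A : ι → Fin m → ZMod q // ∀ p, ∑ i, A p i * v i = 0} * q ^ Fintype.card ι =
      q ^ (Fintype.card ι * m) := by
  classical
  let f : (ι → Fin m → ZMod q) →+ (ι → ZMod q) :=
    { toFun := fun A p => ∑ i, A p i * v i
      map_zero' := by ext; simp
      map_add' := fun A B => by ext; simp [add_mul, Finset.sum_add_distrib] }
  have hsurj : Function.Surjective f := by
    intro w
    obtain ⟨i, hi⟩ := Function.ne_iff.mp hv
    refine ⟨fun p => Pi.single i (w p * (v i)⁻¹), ?_⟩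
    ext p
    change ∑ i', (Pi.single i (w p * (v i)⁻¹) : Fin m → ZMod q) i' * v i' = w p
    rw [Finset.sum_eq_single i]
    · simp at hi; simp [hi]
    · intro b _ hb; simp [hb]
    · simp
  have h1 : Nat.card f.ker * Nat.card f.range = Nat.card (ι → Fin m → ZMod q) := by
    rw [← AddSubgroup.index_ker, AddSubgroup.card_mul_index]
  have h2 : Nat.card f.range = q ^ Fintype.card ι := by
    rw [AddMonoidHom.range_eq_top.mpr hsurj, AddSubgroup.card_top]
    simp [Nat.card_eq_fintype_card]
  have h3 : Nat.card (ι → Fin m → ZMod q) = q ^ (Fintype.card ι * m) := by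
    simp only [Nat.card_eq_fintype_card, Fintype.card_fun, ZMod.card, Fintype.card_fin]
    rw [← pow_mul, mul_comm]
  rw [h2, h3] at h1
  rw [← h1]
  congr 1
  refine Nat.card_congr (Equiv.subtypeEquivRight fun A => ?_)
  exact funext_iff.symm

lemma IsUniformLaw.measure_blockMap_eq_zero {d q : ℕ} [Fact q.Prime]
    {μ : Measure (Fin d → ℕ → ℕ → ZMod q)} (hμ : IsUniformLaw μ) (m : ℕ) (k : Fin d → ℕ)
    (v : Fin m → ZMod q) :
    MeasurableSet {C : Fin d → ℕ → ℕ → ZMod q | blockMap C m k v = 0} ∧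
      (v ≠ 0 → μ {C | blockMap C m k v = 0} = ((q : ENNReal) ^ ∑ j, k j)⁻¹) := by
  classical
  let S : Finset ((Σ j, Fin (k j)) → Fin m → ZMod q) :=
    Finset.univ.filter fun A => ∀ p, ∑ i, A p i * v i = 0
  have hset : {C : Fin d → ℕ → ℕ → ZMod q | blockMap C m k v = 0} =
      ⋃ A ∈ S, {C | (fun (p : Σ j, Fin (k j)) (i : Fin m) => C p.1 p.2 i) = A} := by
    ext C
    simp [S, blockMap, funext_iff (f := fun _ => Finset.sum _ _)]
  rw [hset]
  refine ⟨Finset.measurableSet_biUnion _ fun A _ => (hμ.measure_block_eq m k A).1, fun hv => ?_⟩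
  rw [measure_biUnion_finset _ fun A _ => (hμ.measure_block_eq m k A).1]
  · simp only [(hμ.measure_block_eq m k _).2, Finset.sum_const, nsmul_eq_mul]
    have h := card_matrix_mulVec_eq_zero (ι := Σ j, Fin (k j)) hv
    rw [Nat.card_eq_fintype_card, Fintype.card_subtype] at h
    change S.card * _ = _ at h
    simp only [Fintype.card_sigma, Fintype.card_fin] at h
    have hq0 : (q : ENNReal) ≠ 0 := by exact_mod_cast (Fact.out : q.Prime).ne_zero
    have hqt : (q : ENNReal) ≠ ⊤ := ENNReal.natCast_ne_top q
    have h' : (S.card : ENNReal) * (q : ENNReal) ^ (∑ j, k j) =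
        (q : ENNReal) ^ ((∑ j, k j) * m) := by exact_mod_cast h
    rw [← ENNReal.inv_pow]
    apply ENNReal.eq_inv_of_mul_eq_one_left
    rw [mul_right_comm, h']
    exact ENNReal.mul_inv_cancel (pow_ne_zero _ hq0) (ENNReal.pow_ne_top hqt)
  · intro A _ B _ hAB
    refine Set.disjoint_left.mpr fun C hA hB => hAB ?_
    exact Eq.trans (Eq.symm hA) hB

lemma IsUniformLaw.measurable_excess {d q : ℕ} [Fact q.Prime]
    {μ : Measure (Fin d → ℕ → ℕ → ZMod q)} (hμ : IsUniformLaw μ)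
    (m : ℕ) (k : Fin d → ℕ) :
    Measurable fun C : Fin d → ℕ → ℕ → ZMod q => excess C m k := by
  classical
  have h : ∀ C : Fin d → ℕ → ℕ → ZMod q, Nat.card (blockMap C m k).ker =
      ∑ v, Set.indicator {C | blockMap C m k v = 0} (fun _ => 1) C := by
    intro C
    rw [Nat.card_eq_fintype_card, Fintype.card_subtype, Finset.card_filter]
    simp [Set.indicator_apply, AddMonoidHom.mem_ker]
  simp only [excess, h]
  refine (Finset.measurable_sum _ fun v _ => ?_).sub_const _
  exact measurable_const.indicator (hμ.measure_blockMap_eq_zero m k v).1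

lemma IsUniformLaw.lintegral_excess_le {d q : ℕ} [Fact q.Prime]
    {μ : Measure (Fin d → ℕ → ℕ → ZMod q)} [IsProbabilityMeasure μ] (hμ : IsUniformLaw μ)
    {m : ℕ} {k : Fin d → ℕ} (hk : ∑ j, k j ≤ m) :
    ∫⁻ C, (excess C m k : ENNReal) ∂μ ≤ 1 := by
  classical
  have hq0 : (q : ENNReal) ≠ 0 := by exact_mod_cast (Fact.out : q.Prime).ne_zero
  have hqt : (q : ENNReal) ≠ ⊤ := ENNReal.natCast_ne_top q
  have h : ∀ C : Fin d → ℕ → ℕ → ZMod q,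
      (excess C m k : ENNReal) + (q : ENNReal) ^ (m - ∑ j, k j) =
      ∑ v, Set.indicator {C | blockMap C m k v = 0} (fun _ => (1 : ENNReal)) C := by
    intro C
    have h1 := card_ker_eq_excess_add C hk
    rw [Nat.card_eq_fintype_card, Fintype.card_subtype, Finset.card_filter] at h1
    have h2 := congrArg (Nat.cast (R := ENNReal)) h1
    push_cast at h2
    rw [← h2]
    simp [Set.indicator_apply, AddMonoidHom.mem_ker]
  have h2 : ∫⁻ C, (excess C m k : ENNReal) ∂μ + (q : ENNReal) ^ (m - ∑ j, k j) =
      ∑ v, μ {C | blockMap C m k v = 0} := by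
    calc _ = ∫⁻ C, ((excess C m k : ENNReal) + (q : ENNReal) ^ (m - ∑ j, k j)) ∂μ := by
          rw [lintegral_add_right _ measurable_const]; simp
      _ = _ := by
          simp only [h]
          rw [lintegral_finsetSum]
          · refine Finset.sum_congr rfl fun v _ => ?_
            rw [lintegral_indicator (hμ.measure_blockMap_eq_zero m k v).1]
            simp
          · intro v _
            exact measurable_const.indicator (hμ.measure_blockMap_eq_zero m k v).1
  have h3 : ∑ v, μ {C | blockMap C m k v = 0} ≤ 1 + (q : ENNReal) ^ (m - ∑ j, k j) := by
    rw [← Finset.add_sum_erase _ _ (Finset.mem_univ (0 : Fin m → ZMod q))]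
    refine add_le_add prob_le_one ?_
    calc _ = ∑ v ∈ Finset.univ.erase (0 : Fin m → ZMod q), ((q : ENNReal) ^ ∑ j, k j)⁻¹ :=
          Finset.sum_congr rfl fun v hv =>
            (hμ.measure_blockMap_eq_zero m k v).2 (Finset.ne_of_mem_erase hv)
      _ ≤ ∑ v : Fin m → ZMod q, ((q : ENNReal) ^ ∑ j, k j)⁻¹ :=
          Finset.sum_le_sum_of_subset (Finset.erase_subset _ _)
      _ = (q : ENNReal) ^ (m - ∑ j, k j) := by
          simp only [Finset.sum_const, Finset.card_univ, Fintype.card_fun, ZMod.card,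
            Fintype.card_fin, nsmul_eq_mul]
          push_cast
          nth_rewrite 1 [← Nat.sub_add_cancel hk]
          rw [pow_add, mul_assoc, ENNReal.mul_inv_cancel (pow_ne_zero _ hq0)
            (ENNReal.pow_ne_top hqt), mul_one]
  rw [← h2] at h3
  exact (ENNReal.add_le_add_iff_right (ENNReal.pow_ne_top hqt)).mp h3

lemma IsUniformLaw.measure_excess_ne_zero_le {d q : ℕ} [Fact q.Prime]
    {μ : Measure (Fin d → ℕ → ℕ → ZMod q)} [IsProbabilityMeasure μ] (hμ : IsUniformLaw μ)
    {m : ℕ} {k : Fin d → ℕ} (hk : ∑ j, k j ≤ m) :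
    μ {C | excess C m k ≠ 0} ≤ ((q : ENNReal) ^ (m - ∑ j, k j))⁻¹ := by
  have hq0 : (q : ENNReal) ≠ 0 := by exact_mod_cast (Fact.out : q.Prime).ne_zero
  have hqt : (q : ENNReal) ≠ ⊤ := ENNReal.natCast_ne_top q
  calc μ {C | excess C m k ≠ 0}
      ≤ μ {C | (q : ENNReal) ^ (m - ∑ j, k j) ≤ (excess C m k : ENNReal)} := by
        refine measure_mono fun C hC => ?_
        have := le_excess C hk hC
        simp only [Set.mem_ofPred_eq]
        exact_mod_cast this
    _ ≤ (∫⁻ C, (excess C m k : ENNReal) ∂μ) / (q : ENNReal) ^ (m - ∑ j, k j) :=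
        meas_ge_le_lintegral_div
          ((measurable_of_countable _).comp (hμ.measurable_excess m k)).aemeasurable
          (pow_ne_zero _ hq0) (ENNReal.pow_ne_top hqt)
    _ ≤ 1 / (q : ENNReal) ^ (m - ∑ j, k j) := by gcongr; exact hμ.lintegral_excess_le hk
    _ = _ := one_div _

/-- The base-`q` cells of order `k` used in the canonical decomposition of `[0, B)` inside
`[0, q ^ m)`. -/
def layer (q m B k : ℕ) : Finset ℕ := Finset.Ico (q * (B / q ^ (m - k) / q)) (B / q ^ (m - k))

/-- The base-`q` cells of order `k` lying in the cell of order `k - 1` that contains `B`. -/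
def edge (q m B k : ℕ) : Finset ℕ :=
  (Finset.range (q ^ k)).filter fun c => c / q = B / q ^ (m - k) / q

lemma card_layer_le {q : ℕ} (hq : 0 < q) (m B k : ℕ) : (layer q m B k).card ≤ q := by
  have := Nat.div_add_mod (B / q ^ (m - k)) q
  have := Nat.mod_lt (B / q ^ (m - k)) hq
  rw [layer, Nat.card_Ico]
  omega

lemma card_edge_le {q : ℕ} (hq : 0 < q) (m B k : ℕ) : (edge q m B k).card ≤ q := by
  have h : edge q m B k ⊆ Finset.Ico (q * (B / q ^ (m - k) / q)) (q * (B / q ^ (m - k) / q) + q) := by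
    intro c hc
    have hc := (Finset.mem_filter.mp hc).2
    have h1 := Nat.div_add_mod c q
    have h2 := Nat.mod_lt c hq
    rw [hc] at h1
    rw [Finset.mem_Ico]
    omega
  refine (Finset.card_le_card h).trans ?_
  simp

lemma lt_of_mem_layer {q m B k c : ℕ} (hq : 0 < q) (hB : B ≤ q ^ m) (hk : k ≤ m)
    (hc : c ∈ layer q m B k) : c < q ^ k := by
  refine (Finset.mem_Ico.mp hc).2.trans_le ?_
  calc B / q ^ (m - k) ≤ q ^ m / q ^ (m - k) := Nat.div_le_div_right hB
    _ = q ^ k := by rw [Nat.pow_div (Nat.sub_le _ _) hq, Nat.sub_sub_self hk]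

lemma mem_edge_of_mem_layer {q m B k k' t : ℕ} (hq : 0 < q) (ht : t < q ^ m) (hk : k ≤ m)
    (hk' : k' ≤ k) (h : t / q ^ (m - k) ∈ layer q m B k) :
    t / q ^ (m - k') ∈ edge q m B k' := by
  rw [edge, Finset.mem_filter, Finset.mem_range]
  constructor
  · rw [Nat.div_lt_iff_lt_mul (by positivity), ← pow_add]
    convert ht using 2
    omega
  · obtain ⟨h1, h2⟩ := Finset.mem_Ico.mp h
    have h3 : t / q ^ (m - k) / q = B / q ^ (m - k) / q := by
      apply le_antisymm (Nat.div_le_div_right h2.le)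
      rw [Nat.le_div_iff_mul_le hq, mul_comm]
      exact h1
    have h4 : ∀ x : ℕ, x / q ^ (m - k') / q = x / q ^ (m - k) / q / q ^ (k - k') := by
      intro x
      simp only [Nat.div_div_eq_div_mul]
      rw [mul_right_comm, ← pow_add]
      congr 3
      omega
    rw [h4, h3, ← h4]

lemma sum_layer {q m B t : ℕ} (hq : 2 ≤ q) (hB : B ≤ q ^ m) :
    ∑ k ∈ Finset.range (m + 1), (if t / q ^ (m - k) ∈ layer q m B k then (1 : ℝ) else 0) =
      if t < B then 1 else 0 := by
  let g : ℕ → ℝ := fun e => if t / q ^ e < B / q ^ e then 1 else 0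
  have h1 : ∀ k, (if t / q ^ (m - k) ∈ layer q m B k then (1 : ℝ) else 0) =
      g (m - k) - g (m - k + 1) := by
    intro k
    simp only [g, layer, Finset.mem_Ico, pow_succ, ← Nat.div_div_eq_div_mul]
    generalize t / q ^ (m - k) = x
    generalize B / q ^ (m - k) = b
    have h2 : q * (b / q) ≤ x ↔ ¬ (x / q < b / q) := by
      rw [not_lt, Nat.le_div_iff_mul_le (by omega), mul_comm]
    have h3 : x / q < b / q → x < b := by
      intro h
      by_contra! h'
      exact absurd (Nat.div_le_div_right (c := q) h') (by omega)
    simp only [h2]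
    by_cases hx : x / q < b / q
    · simp [hx, h3 hx]
    · simp [hx]
  simp only [h1]
  have h2 := Finset.sum_range_reflect (fun e => g e - g (e + 1)) (m + 1)
  simp only [Nat.add_sub_cancel] at h2
  rw [h2, Finset.sum_range_sub']
  have h3 : B / q ^ (m + 1) = 0 := by
    apply Nat.div_eq_of_lt
    exact hB.trans_lt (Nat.pow_lt_pow_right (by omega) (by omega))
  simp [g, h3]

/-- The shapes of elementary intervals of order at most `m`. -/
def lowShapes (d m : ℕ) : Finset (Fin d → ℕ) :=
  (Fintype.piFinset fun _ => Finset.range (m + 1)).filter fun k => ∑ j, k j ≤ m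

lemma mem_lowShapes {d m : ℕ} {k : Fin d → ℕ} : k ∈ lowShapes d m ↔ ∑ j, k j ≤ m := by
  rw [lowShapes, Finset.mem_filter, Fintype.mem_piFinset, and_iff_right_iff_imp]
  intro h j
  rw [Finset.mem_range]
  have := Finset.single_le_sum (f := k) (fun i _ => Nat.zero_le _) (Finset.mem_univ j)
  omega

lemma card_filter_lowShapes_le {d : ℕ} (hd : 1 ≤ d) (m s : ℕ) :
    ((lowShapes d m).filter fun k => m ≤ ∑ j, k j + s).card ≤ (s + 1) * (m + 1) ^ (d - 1) := by
  obtain ⟨n, rfl⟩ := Nat.exists_eq_add_of_le' hd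
  have h := Finset.card_le_card_of_injOn
    (s := (lowShapes (n + 1) m).filter fun k => m ≤ ∑ j, k j + s)
    (t := Finset.range (s + 1) ×ˢ Fintype.piFinset fun _ : Fin n => Finset.range (m + 1))
    (fun k => (m - ∑ j, k j, fun j => k j.succ)) ?_ ?_
  · simpa using h
  · intro k hk
    simp only [Finset.coe_filter, Set.mem_ofPred_eq, mem_lowShapes] at hk
    simp only [Finset.coe_product, Set.mem_prod, Finset.mem_coe, Finset.mem_range,
      Fintype.mem_piFinset]
    refine ⟨by omega, fun j => ?_⟩
    have := Finset.single_le_sum (f := k) (fun i _ => Nat.zero_le _) (Finset.mem_univ j.succ)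
    omega
  · intro k hk k' hk' h
    simp only [Finset.coe_filter, Set.mem_ofPred_eq, mem_lowShapes] at hk hk'
    simp only [Prod.mk.injEq, funext_iff] at h
    obtain ⟨h1, h2⟩ := h
    have h3 : ∑ j, k j = ∑ j, k' j := by omega
    rw [Fin.sum_univ_succ, Fin.sum_univ_succ, Finset.sum_congr rfl fun j _ => h2 j] at h3
    ext j
    refine Fin.cases (by omega) h2 j

lemma exists_le_sum_eq {d : ℕ} (k : Fin d → ℕ) (m : ℕ) (h : m ≤ ∑ j, k j) :
    ∃ k' : Fin d → ℕ, k' ≤ k ∧ ∑ j, k' j = m := by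
  induction d generalizing m with
  | zero => exact ⟨k, le_rfl, by simp at h ⊢; omega⟩
  | succ n ih =>
    rw [Fin.sum_univ_succ] at h
    obtain ⟨k', h1, h2⟩ := ih (fun j => k j.succ) (m - min (k 0) m) (by omega)
    refine ⟨Fin.cons (min (k 0) m) k', fun j => ?_, ?_⟩
    · refine Fin.cases ?_ (fun i => ?_) j
      · simp
      · simpa using h1 i
    · rw [Fin.sum_univ_succ]
      simp only [Fin.cons_zero, Fin.cons_succ, h2]
      omega

lemma sum_piFinset_ite_eq {d : ℕ} (S : Fin d → Finset ℕ) (x : Fin d → ℕ) :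
    ∑ c ∈ Fintype.piFinset S, (if ∀ j, x j = c j then (1 : ℝ) else 0) =
      if ∀ j, x j ∈ S j then 1 else 0 := by
  classical
  simp only [← funext_iff]
  rw [Finset.sum_ite_eq]
  simp only [Fintype.mem_piFinset]

lemma abs_indicator_sub_low_le {d q m : ℕ} (hq : 2 ≤ q) (B τ : Fin d → ℕ)
    (hB : ∀ j, B j ≤ q ^ m) (hτ : ∀ j, τ j < q ^ m) :
    |(if ∀ j, τ j < B j then (1 : ℝ) else 0) - ∑ k ∈ lowShapes d m,
        ∑ c ∈ Fintype.piFinset fun j => layer q m (B j) (k j),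
          if ∀ j, τ j / q ^ (m - k j) = c j then (1 : ℝ) else 0| ≤
      ∑ k ∈ (lowShapes d m).filter fun k => m ≤ ∑ j, k j,
        ∑ c ∈ Fintype.piFinset fun j => edge q m (B j) (k j),
          if ∀ j, τ j / q ^ (m - k j) = c j then (1 : ℝ) else 0 := by
  simp only [sum_piFinset_ite_eq]
  set a : (Fin d → ℕ) → ℝ := fun k =>
    if ∀ j, τ j / q ^ (m - k j) ∈ layer q m (B j) (k j) then 1 else 0 with ha
  have ha0 : ∀ k, 0 ≤ a k := fun k => by simp only [ha]; split_ifs <;> simp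
  have hall : (if ∀ j, τ j < B j then (1 : ℝ) else 0) =
      ∑ k ∈ Fintype.piFinset fun _ : Fin d => Finset.range (m + 1), a k := by
    have h1 : ∀ (p : Fin d → Prop) [DecidablePred p],
        (if ∀ j, p j then (1 : ℝ) else 0) = ∏ j, if p j then 1 else 0 := by
      intro p _
      rw [Finset.prod_ite_zero]
      simp
    simp only [ha, h1]
    refine Eq.trans ?_ (Finset.prod_univ_sum (fun _ : Fin d => Finset.range (m + 1))
      fun j k => if τ j / q ^ (m - k) ∈ layer q m (B j) k then (1 : ℝ) else 0)
    exact Finset.prod_congr rfl fun j _ => (sum_layer hq (hB j)).symm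
  have hsplit := Finset.sum_filter_add_sum_filter_not
    (Fintype.piFinset fun _ : Fin d => Finset.range (m + 1)) (fun k => ∑ j, k j ≤ m) a
  rw [← hall] at hsplit
  change ∑ k ∈ lowShapes d m, a k + _ = _ at hsplit
  rw [← hsplit, add_sub_cancel_left, abs_of_nonneg (Finset.sum_nonneg fun k _ => ha0 k)]
  have hlow : 0 ≤ ∑ k ∈ lowShapes d m, a k := Finset.sum_nonneg fun k _ => ha0 k
  have hone : (if ∀ j, τ j < B j then (1 : ℝ) else 0) ≤ 1 := by split_ifs <;> simp
  have hnn : ∀ k : Fin d → ℕ, (0 : ℝ) ≤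
      if ∀ j, τ j / q ^ (m - k j) ∈ edge q m (B j) (k j) then 1 else 0 :=
    fun k => by split_ifs <;> simp
  by_cases h : ∃ k ∈ (Fintype.piFinset fun _ : Fin d => Finset.range (m + 1)).filter
      fun k => ¬ ∑ j, k j ≤ m, a k ≠ 0
  · obtain ⟨k, hk, hak⟩ := h
    rw [Finset.mem_filter, Fintype.mem_piFinset] at hk
    have hmem : ∀ j, τ j / q ^ (m - k j) ∈ layer q m (B j) (k j) := by
      by_contra hne
      exact hak (if_neg hne)
    obtain ⟨k', hk', hsum⟩ := exists_le_sum_eq k m (by omega)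
    refine le_trans ?_ (Finset.single_le_sum (fun k _ => hnn k) (a := k') ?_)
    · rw [if_pos fun j => mem_edge_of_mem_layer (by omega) (hτ j)
        (by have := Finset.mem_range.mp (hk.1 j); omega) (hk' j) (hmem j)]
      linarith
    · rw [Finset.mem_filter, mem_lowShapes]
      omega
  · rw [Finset.sum_eq_zero fun k hk => by_contra fun hak => h ⟨k, hk, hak⟩]
    exact Finset.sum_nonneg fun k _ => hnn k

lemma abs_card_sub_low_le {α : Type*} {d q m : ℕ} (hq : 2 ≤ q) (B : Fin d → ℕ)
    (hB : ∀ j, B j ≤ q ^ m) (P : Finset α) (T : α → Fin d → ℕ)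
    (hT : ∀ p ∈ P, ∀ j, T p j < q ^ m) :
    |((P.filter fun p => ∀ j, T p j < B j).card : ℝ) - ∑ k ∈ lowShapes d m,
        ∑ c ∈ Fintype.piFinset fun j => layer q m (B j) (k j),
          ((P.filter fun p => ∀ j, T p j / q ^ (m - k j) = c j).card : ℝ)| ≤
      ∑ k ∈ (lowShapes d m).filter fun k => m ≤ ∑ j, k j,
        ∑ c ∈ Fintype.piFinset fun j => edge q m (B j) (k j),
          ((P.filter fun p => ∀ j, T p j / q ^ (m - k j) = c j).card : ℝ) := by
  have h1 := Finset.sum_le_sum fun p hp => abs_indicator_sub_low_le hq B (T p) hB (hT p hp)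
  have h2 := (Finset.abs_sum_le_sum_abs _ _).trans h1
  rw [Finset.sum_sub_distrib] at h2
  simp only [Finset.card_filter, Nat.cast_sum, Nat.cast_ite, Nat.cast_one, Nat.cast_zero]
  have h3 : ∀ (K : Finset (Fin d → ℕ)) (S : (Fin d → ℕ) → Fin d → Finset ℕ),
      ∑ p ∈ P, ∑ k ∈ K, ∑ c ∈ Fintype.piFinset (S k),
        (if ∀ j, T p j / q ^ (m - k j) = c j then (1 : ℝ) else 0) =
      ∑ k ∈ K, ∑ c ∈ Fintype.piFinset (S k), ∑ p ∈ P,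
        (if ∀ j, T p j / q ^ (m - k j) = c j then (1 : ℝ) else 0) := by
    intro K S
    rw [Finset.sum_comm]
    exact Finset.sum_congr rfl fun k _ => Finset.sum_comm
  rw [h3 _ fun k j => layer q m (B j) (k j), h3 _ fun k j => edge q m (B j) (k j)] at h2
  exact h2

lemma card_grid_cell {d q m : ℕ} (hq : 0 < q) {k : Fin d → ℕ} (hk : ∀ j, k j ≤ m)
    {c : Fin d → ℕ} (hc : ∀ j, c j < q ^ k j) :
    (((Fintype.piFinset fun _ : Fin d => Finset.range (q ^ m)).filter
      fun t => ∀ j, t j / q ^ (m - k j) = c j).card : ℝ) =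
      ((q : ℝ) ^ m) ^ d / q ^ ∑ j, k j := by
  have h1 : (Fintype.piFinset fun _ : Fin d => Finset.range (q ^ m)).filter
      (fun t => ∀ j, t j / q ^ (m - k j) = c j) =
      Fintype.piFinset fun j => Finset.Ico (c j * q ^ (m - k j)) ((c j + 1) * q ^ (m - k j)) := by
    ext t
    simp only [Finset.mem_filter, Fintype.mem_piFinset, ← forall_and]
    refine forall_congr' fun j => ?_
    have hpos : 0 < q ^ (m - k j) := by positivity
    rw [Finset.mem_range, Finset.mem_Ico]
    constructor
    · rintro ⟨_, h⟩
      rw [← h]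
      exact ⟨Nat.div_mul_le_self _ _, by rw [mul_comm]; exact Nat.lt_mul_div_succ _ hpos⟩
    · rintro ⟨h2, h3⟩
      refine ⟨h3.trans_le ?_, ?_⟩
      · calc (c j + 1) * q ^ (m - k j) ≤ q ^ k j * q ^ (m - k j) := by
              gcongr; exact hc j
          _ = q ^ m := by rw [← pow_add]; congr 1; have := hk j; omega
      · exact Nat.div_eq_of_lt_le h2 h3
  rw [h1, Fintype.card_piFinset]
  simp only [Nat.card_Ico, add_mul, one_mul, Nat.add_sub_cancel_left]
  have hq' : (q : ℝ) ≠ 0 := by positivity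
  rw [← Finset.prod_pow_eq_pow_sum]
  push_cast
  rw [eq_div_iff (Finset.prod_ne_zero_iff.mpr fun j _ => pow_ne_zero _ hq'),
    ← Finset.prod_mul_distrib]
  rw [Finset.prod_congr rfl fun j _ => show (q : ℝ) ^ (m - k j) * q ^ k j = q ^ m by
    rw [← pow_add, Nat.sub_add_cancel (hk j)]]
  simp

lemma abs_card_sub_volume_le {α : Type*} {d q m : ℕ} (hd : 1 ≤ d) (hq : 2 ≤ q) (B : Fin d → ℕ)
    (hB : ∀ j, B j ≤ q ^ m) (P : Finset α) (T : α → Fin d → ℕ)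
    (hT : ∀ p ∈ P, ∀ j, T p j < q ^ m) (Y : (Fin d → ℕ) → ℝ) (hY : ∀ k, 0 ≤ Y k)
    (hcell : ∀ k : Fin d → ℕ, ∑ j, k j ≤ m → ∀ c : Fin d → ℕ, (∀ j, c j < q ^ k j) →
      |((P.filter fun p => ∀ j, T p j / q ^ (m - k j) = c j).card : ℝ)
        - (q : ℝ) ^ (m - ∑ j, k j)| ≤ Y k) :
    |((P.filter fun p => ∀ j, T p j < B j).card : ℝ)
        - (q : ℝ) ^ m * ∏ j, ((B j : ℝ) / q ^ m)| ≤
      2 * q ^ d * (∑ k ∈ lowShapes d m, Y k + (m + 1) ^ (d - 1)) := by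
  have hq0 : (0 : ℝ) < q := by exact_mod_cast (by omega : 0 < q)
  have hk_le : ∀ k ∈ lowShapes d m, ∀ j, k j ≤ m := by
    intro k hk j
    have h1 := mem_lowShapes.mp hk
    have := Finset.single_le_sum (f := k) (fun i _ => Nat.zero_le _) (Finset.mem_univ j)
    omega
  set G := Fintype.piFinset fun _ : Fin d => Finset.range (q ^ m) with hG
  set lam : ℝ := q ^ m / (q ^ m) ^ d with hlam
  have hlam0 : 0 < lam := by positivity
  have hgrid : ∀ k ∈ lowShapes d m, ∀ c : Fin d → ℕ, (∀ j, c j < q ^ k j) →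
      lam * ((G.filter fun t => ∀ j, t j / q ^ (m - k j) = c j).card : ℝ) =
        (q : ℝ) ^ (m - ∑ j, k j) := by
    intro k hk c hc
    rw [card_grid_cell (by omega) (hk_le k hk) hc, hlam, pow_sub₀ _ hq0.ne' (mem_lowShapes.mp hk)]
    field_simp
  have hP := abs_card_sub_low_le hq B hB P T hT
  have hGr := abs_card_sub_low_le hq B hB G (fun t => t)
    (fun t ht j => Finset.mem_range.mp (Fintype.mem_piFinset.mp ht j))
  have hvol : lam * ((G.filter fun t => ∀ j, t j < B j).card : ℝ) =
      (q : ℝ) ^ m * ∏ j, ((B j : ℝ) / q ^ m) := by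
    have h1 : (G.filter fun t => ∀ j, t j < B j) =
        Fintype.piFinset fun j => Finset.range (B j) := by
      ext t
      simp only [hG, Finset.mem_filter, Fintype.mem_piFinset, ← forall_and, Finset.mem_range]
      exact forall_congr' fun j => ⟨fun h => h.2, fun h => ⟨h.trans_le (hB j), h⟩⟩
    rw [h1, Fintype.card_piFinset, Finset.prod_div_distrib]
    simp [hlam]
    field_simp
  rw [← hvol]
  set X : ℝ := ((P.filter fun p => ∀ j, T p j < B j).card : ℝ)
  set V : ℝ := ((G.filter fun t => ∀ j, t j < B j).card : ℝ)
  set top := (lowShapes d m).filter fun k => m ≤ ∑ j, k j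
  have hlay : ∀ k ∈ lowShapes d m, ∀ c ∈ Fintype.piFinset fun j => layer q m (B j) (k j),
      ∀ j, c j < q ^ k j := fun k hk c hc j =>
    lt_of_mem_layer (by omega) (hB j) (hk_le k hk j) (Fintype.mem_piFinset.mp hc j)
  have hedge : ∀ k : Fin d → ℕ, ∀ c ∈ Fintype.piFinset fun j => edge q m (B j) (k j),
      ∀ j, c j < q ^ k j := fun k c hc j =>
    Finset.mem_range.mp (Finset.mem_filter.mp (Fintype.mem_piFinset.mp hc j)).1
  have hcardL : ∀ k : Fin d → ℕ,
      ((Fintype.piFinset fun j => layer q m (B j) (k j)).card : ℝ) ≤ q ^ d := by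
    intro k
    rw [Fintype.card_piFinset]
    have := Finset.prod_le_pow_card Finset.univ (fun j => (layer q m (B j) (k j)).card) q
      fun j _ => card_layer_le (by omega) m (B j) (k j)
    simp only [Finset.card_univ, Fintype.card_fin] at this
    exact_mod_cast this
  have hcardE : ∀ k : Fin d → ℕ,
      ((Fintype.piFinset fun j => edge q m (B j) (k j)).card : ℝ) ≤ q ^ d := by
    intro k
    rw [Fintype.card_piFinset]
    have := Finset.prod_le_pow_card Finset.univ (fun j => (edge q m (B j) (k j)).card) q
      fun j _ => card_edge_le (by omega) m (B j) (k j)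
    simp only [Finset.card_univ, Fintype.card_fin] at this
    exact_mod_cast this
  set LP := ∑ k ∈ lowShapes d m, ∑ c ∈ Fintype.piFinset fun j => layer q m (B j) (k j),
    ((P.filter fun p => ∀ j, T p j / q ^ (m - k j) = c j).card : ℝ)
  set LG := ∑ k ∈ lowShapes d m, ∑ c ∈ Fintype.piFinset fun j => layer q m (B j) (k j),
    ((G.filter fun t => ∀ j, t j / q ^ (m - k j) = c j).card : ℝ)
  have h1 : |LP - lam * LG| ≤ q ^ d * ∑ k ∈ lowShapes d m, Y k := by
    simp only [LP, LG, Finset.mul_sum, ← Finset.sum_sub_distrib]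
    refine (Finset.abs_sum_le_sum_abs _ _).trans (Finset.sum_le_sum fun k hk => ?_)
    refine (Finset.abs_sum_le_sum_abs _ _).trans ?_
    refine (Finset.sum_le_card_nsmul _ _ (Y k) fun c hc => ?_).trans ?_
    · rw [hgrid k hk c (hlay k hk c hc)]
      exact hcell k (mem_lowShapes.mp hk) c (hlay k hk c hc)
    · rw [nsmul_eq_mul]
      exact mul_le_mul_of_nonneg_right (hcardL k) (hY k)
  have hsub0 : ∀ k ∈ top, k ∈ lowShapes d m ∧ m - ∑ j, k j = 0 := fun k hk =>
    ⟨(Finset.mem_filter.mp hk).1, by have := (Finset.mem_filter.mp hk).2; omega⟩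
  have h2 : |X - LP| ≤ q ^ d * ∑ k ∈ top, (Y k + 1) := by
    refine hP.trans ?_
    rw [Finset.mul_sum]
    refine Finset.sum_le_sum fun k hk => ?_
    refine (Finset.sum_le_card_nsmul _ _ (Y k + 1) fun c hc => ?_).trans ?_
    · have := hcell k (mem_lowShapes.mp (hsub0 k hk).1) c (hedge k c hc)
      rw [(hsub0 k hk).2, pow_zero] at this
      linarith [(abs_le.mp this).2]
    · rw [nsmul_eq_mul]
      exact mul_le_mul_of_nonneg_right (hcardE k) (by linarith [hY k])
  have h3 : |V * lam - LG * lam| ≤ q ^ d * ∑ k ∈ top, 1 := by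
    rw [← sub_mul, abs_mul, abs_of_pos hlam0]
    refine (mul_le_mul_of_nonneg_right hGr hlam0.le).trans ?_
    rw [mul_comm, Finset.mul_sum, Finset.mul_sum]
    refine Finset.sum_le_sum fun k hk => ?_
    rw [Finset.mul_sum]
    refine (Finset.sum_le_card_nsmul _ _ 1 fun c hc => ?_).trans ?_
    · rw [hgrid k (hsub0 k hk).1 c (hedge k c hc), (hsub0 k hk).2, pow_zero]
    · rw [nsmul_eq_mul]
      exact mul_le_mul_of_nonneg_right (hcardE k) (by norm_num)
  have htop : ((top.card : ℕ) : ℝ) ≤ (m + 1) ^ (d - 1) := by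
    have := card_filter_lowShapes_le hd m 0
    simp only [add_zero, zero_add, one_mul] at this
    exact_mod_cast this
  have hYtop : ∑ k ∈ top, Y k ≤ ∑ k ∈ lowShapes d m, Y k :=
    Finset.sum_le_sum_of_subset_of_nonneg (Finset.filter_subset _ _) fun k _ _ => hY k
  have h4 : |X - lam * V| ≤ |X - LP| + |LP - lam * LG| + |V * lam - LG * lam| := by
    have h5 : X - lam * V = (X - LP) + (LP - lam * LG) - (V * lam - LG * lam) := by ring
    rw [h5]
    exact (abs_sub _ _).trans (by gcongr; exact abs_add_le _ _)
  rw [Finset.sum_add_distrib] at h2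
  simp only [Finset.sum_const, nsmul_eq_mul, mul_one] at h2 h3
  calc |X - lam * V| ≤ q ^ d * (∑ k ∈ top, Y k + top.card) + q ^ d * ∑ k ∈ lowShapes d m, Y k
        + q ^ d * top.card := by linarith
    _ = q ^ d * (∑ k ∈ top, Y k + ∑ k ∈ lowShapes d m, Y k + 2 * top.card) := by ring
    _ ≤ q ^ d * (∑ k ∈ lowShapes d m, Y k + ∑ k ∈ lowShapes d m, Y k
          + 2 * (m + 1) ^ (d - 1)) := by gcongr
    _ = _ := by ring

/-- The integer with base-`q` digits `y 0, …, y (k - 1)`, most significant digit first. -/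
def prefixNum {q : ℕ} (y : ℕ → ZMod q) : ℕ → ℕ
  | 0 => 0
  | k + 1 => q * prefixNum y k + (y k).val

lemma prefixNum_lt {q : ℕ} [NeZero q] (y : ℕ → ZMod q) (k : ℕ) : prefixNum y k < q ^ k := by
  induction k with
  | zero => simp [prefixNum]
  | succ k ih =>
    have h := ZMod.val_lt (y k)
    rw [prefixNum, pow_succ]
    nlinarith

lemma prefixNum_add_div {q : ℕ} [NeZero q] (y : ℕ → ZMod q) (k e : ℕ) :
    prefixNum y (k + e) / q ^ e = prefixNum y k := by
  induction e with
  | zero => simp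
  | succ e ih =>
    have h := ZMod.val_lt (y (k + e))
    rw [← add_assoc, prefixNum, pow_succ', ← Nat.div_div_eq_div_mul,
      Nat.mul_add_div (NeZero.pos q), Nat.div_eq_of_lt h, add_zero, ih]

lemma prefixNum_div {q : ℕ} [NeZero q] (y : ℕ → ZMod q) {k m : ℕ} (hk : k ≤ m) :
    prefixNum y m / q ^ (m - k) = prefixNum y k := by
  have := prefixNum_add_div y k (m - k)
  rwa [Nat.add_sub_cancel' hk] at this

lemma prefixNum_eq_iff {q : ℕ} [NeZero q] (y y' : ℕ → ZMod q) (k : ℕ) :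
    prefixNum y k = prefixNum y' k ↔ ∀ r < k, y r = y' r := by
  induction k with
  | zero => simp [prefixNum]
  | succ k ih =>
    have h := ZMod.val_lt (y k)
    have h' := ZMod.val_lt (y' k)
    have hq := NeZero.pos q
    rw [Nat.forall_lt_succ_right, ← ih, prefixNum, prefixNum]
    constructor
    · intro e
      have e1 := congrArg (· / q) e
      have e2 := congrArg (· % q) e
      simp only [Nat.mul_add_div hq, Nat.div_eq_of_lt h, Nat.div_eq_of_lt h', add_zero,
        Nat.mul_add_mod, Nat.mod_eq_of_lt h, Nat.mod_eq_of_lt h'] at e1 e2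
      exact ⟨e1, ZMod.val_injective q e2⟩
    · rintro ⟨e1, e2⟩
      rw [e1, e2]

lemma exists_prefixNum_eq {q : ℕ} [NeZero q] (k c : ℕ) (hc : c < q ^ k) :
    ∃ y : ℕ → ZMod q, prefixNum y k = c := by
  induction k generalizing c with
  | zero => exact ⟨0, by simp at hc; simp [prefixNum, hc]⟩
  | succ k ih =>
    obtain ⟨y, hy⟩ := ih (c / q) (by
      rw [Nat.div_lt_iff_lt_mul (NeZero.pos q)]; rwa [pow_succ] at hc)
    refine ⟨Function.update y k (c % q : ℕ), ?_⟩
    have h1 : prefixNum (Function.update y k ((c % q : ℕ) : ZMod q)) k = prefixNum y k := by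
      rw [prefixNum_eq_iff]
      intro r hr
      rw [Function.update_of_ne hr.ne]
    rw [prefixNum, h1, hy, Function.update_self, ZMod.val_natCast, Nat.mod_mod]
    exact Nat.div_add_mod c q

lemma tsum_digits_mem_Icc {q : ℕ} (hq : 2 ≤ q) (y : ℕ → ZMod q) (m : ℕ) :
    (prefixNum y m : ℝ) ≤ q ^ m * ∑' r, ((y r).val : ℝ) / q ^ (r + 1) ∧
      (q : ℝ) ^ m * ∑' r, ((y r).val : ℝ) / q ^ (r + 1) ≤ prefixNum y m + 1 := by
  have : NeZero q := ⟨by omega⟩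
  have hq0 : (0 : ℝ) < q := by exact_mod_cast (by omega : 0 < q)
  have hpart : ∀ k, ∑ r ∈ Finset.range k, ((y r).val : ℝ) / q ^ (r + 1) =
      prefixNum y k / q ^ k := by
    intro k
    induction k with
    | zero => simp [prefixNum]
    | succ k ih =>
      rw [Finset.sum_range_succ, ih, prefixNum]
      push_cast
      field_simp
      ring
  have hsum : Summable fun r => ((y r).val : ℝ) / q ^ (r + 1) := by
    refine summable_of_sum_range_le (c := 1) (fun r => by positivity) fun k => ?_
    rw [hpart, div_le_one (by positivity)]
    exact_mod_cast (prefixNum_lt y k).le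
  have hlim := (hsum.hasSum.tendsto_sum_nat).const_mul ((q : ℝ) ^ m)
  have hterm : ∀ e, (q : ℝ) ^ m * ∑ r ∈ Finset.range (m + e), ((y r).val : ℝ) / q ^ (r + 1) =
      prefixNum y (m + e) / q ^ e := by
    intro e
    rw [hpart, pow_add]
    field_simp
  have hdiv := fun e => prefixNum_add_div y m e
  refine ⟨ge_of_tendsto hlim ?_, le_of_tendsto hlim ?_⟩ <;>
  · filter_upwards [Filter.eventually_ge_atTop m] with n hn
    obtain ⟨e, rfl⟩ := Nat.exists_eq_add_of_le hn
    have hpos : 0 < q ^ e := by positivity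
    rw [hterm]
    first
    | rw [le_div_iff₀ (by positivity)]
      exact_mod_cast hdiv e ▸ Nat.div_mul_le_self _ _
    | rw [div_le_iff₀ (by positivity)]
      have h := (Nat.lt_mul_div_succ (prefixNum y (m + e)) hpos).le
      rw [hdiv, mul_comm] at h
      exact_mod_cast h

/-- The `r`-th base-`q` digit of the `j`-th coordinate of the `n`-th point of the digital
sequence generated by `C`. -/
def outDigit {d q : ℕ} (C : Fin d → ℕ → ℕ → ZMod q) (n : ℕ) (j : Fin d) (r : ℕ) : ZMod q :=
  ∑ i ∈ Finset.range (Nat.digits q n).length, C j r i * ((Nat.digits q n).getD i 0 : ZMod q)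

lemma digitalSeq_eq {d q : ℕ} (C : Fin d → ℕ → ℕ → ZMod q) (n : ℕ) (j : Fin d) :
    digitalSeq d C n j = ∑' r, ((outDigit C n j r).val : ℝ) / q ^ (r + 1) := rfl

lemma outDigit_eq_sum {d q : ℕ} (hq : 2 ≤ q) (C : Fin d → ℕ → ℕ → ZMod q) (n : ℕ) (j : Fin d)
    (r : ℕ) {L : ℕ} (hL : (Nat.digits q n).length ≤ L) :
    outDigit C n j r = ∑ i ∈ Finset.range L, C j r i * ((n / q ^ i % q : ℕ) : ZMod q) := by
  rw [outDigit]
  refine Eq.trans ?_ (Finset.sum_subset (Finset.range_subset_range.mpr hL) fun i _ hi => ?_)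
  · exact Finset.sum_congr rfl fun i _ => by rw [Nat.getD_digits n i hq]
  · rw [← Nat.getD_digits n i hq, List.getD_eq_default _ _ (by simpa using hi)]
    simp

lemma outDigit_mul_pow_add {d q : ℕ} (hq : 2 ≤ q) (C : Fin d → ℕ → ℕ → ZMod q) {m b : ℕ}
    (a : ℕ) (hb : b < q ^ m) (j : Fin d) (r : ℕ) :
    outDigit C (q ^ m * a + b) j r =
      outDigit C (q ^ m * a) j r + ∑ i : Fin m, C j r i * ((b / q ^ (i : ℕ) % q : ℕ) : ZMod q) := by
  obtain ⟨L, hL1, hL2⟩ : ∃ L, (Nat.digits q (q ^ m * a + b)).length ≤ L ∧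
      (Nat.digits q (q ^ m * a)).length ≤ L := ⟨_ + _, Nat.le_add_right _ _, Nat.le_add_left _ _⟩
  have hq0 : 0 < q := by omega
  have hlow : ∀ i < m, ∀ b, (q ^ m * a + b) / q ^ i % q = b / q ^ i % q := by
    intro i hi b
    obtain ⟨e, rfl⟩ := Nat.exists_eq_add_of_lt hi
    rw [show q ^ (i + e + 1) * a + b = q ^ i * (q * (q ^ e * a)) + b by ring,
      Nat.mul_add_div (by positivity), Nat.mul_add_mod]
  have hhigh : ∀ i, (q ^ m * a + b) / q ^ (m + i) = (q ^ m * a) / q ^ (m + i) := by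
    intro i
    rw [pow_add, ← Nat.div_div_eq_div_mul, ← Nat.div_div_eq_div_mul,
      Nat.mul_add_div (by positivity), Nat.div_eq_of_lt hb, Nat.mul_div_cancel_left _ (by positivity),
      add_zero]
  rw [outDigit_eq_sum hq C _ j r (L := m + L) (by omega),
    outDigit_eq_sum hq C (q ^ m * a) j r (L := m + L) (by omega),
    Finset.sum_range_add, Finset.sum_range_add]
  simp only [hhigh]
  rw [Finset.sum_congr rfl fun i hi => by rw [hlow i (Finset.mem_range.mp hi) b],
    Finset.sum_eq_zero (s := Finset.range m)
      (f := fun i => C j r i * ((q ^ m * a / q ^ i % q : ℕ) : ZMod q)) fun i hi => by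
      have := hlow i (Finset.mem_range.mp hi) 0
      rw [add_zero] at this
      rw [this]; simp,
    Finset.sum_range, zero_add, add_comm]

lemma card_filter_digits {q : ℕ} (hq : 2 ≤ q) (m : ℕ) (p : (Fin m → ZMod q) → Prop)
    [DecidablePred p] :
    ((Finset.range (q ^ m)).filter
      fun b => p fun i => ((b / q ^ (i : ℕ) % q : ℕ) : ZMod q)).card = Nat.card {v // p v} := by
  have : NeZero q := ⟨by omega⟩
  obtain ⟨q, rfl⟩ := Nat.exists_eq_add_of_le' (show 1 ≤ q by omega)
  let e : Fin ((q + 1) ^ m) ≃ (Fin m → ZMod (q + 1)) := finFunctionFinEquiv.symm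
  have he : ∀ b, e b = fun i : Fin m => (((b : ℕ) / (q + 1) ^ (i : ℕ) % (q + 1) : ℕ) : ZMod (q + 1)) := by
    intro b
    ext i
    apply ZMod.val_injective
    rw [ZMod.val_natCast, Nat.mod_mod]
    rfl
  rw [← Nat.card_congr (e.subtypeEquivOfSubtype (p := p))]
  simp only [he]
  rw [Nat.card_eq_fintype_card, Fintype.card_subtype, Finset.card_filter, Finset.card_filter,
    Finset.sum_range]

lemma abs_card_block_cell_sub_le {d q : ℕ} (hq : 2 ≤ q) (C : Fin d → ℕ → ℕ → ZMod q) (m a : ℕ)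
    (k : Fin d → ℕ) (hk : ∑ j, k j ≤ m) (c : Fin d → ℕ) (hc : ∀ j, c j < q ^ k j) :
    |(((Finset.range (q ^ m)).filter fun b => ∀ j,
        prefixNum (outDigit C (q ^ m * a + b) j) m / q ^ (m - k j) = c j).card : ℝ)
        - (q : ℝ) ^ (m - ∑ j, k j)| ≤ excess C m k := by
  classical
  have : NeZero q := ⟨by omega⟩
  choose y hy using fun j => exists_prefixNum_eq (q := q) (k j) (c j) (hc j)
  let w : (Σ j, Fin (k j)) → ZMod q := fun p => y p.1 p.2 - outDigit C (q ^ m * a) p.1 p.2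
  convert abs_card_fiber_sub_le C hk w using 4
  rw [← card_filter_digits hq]
  congr 1
  refine Finset.filter_congr fun b hb => ?_
  have hkj : ∀ j, k j ≤ m := fun j =>
    (Finset.single_le_sum (f := k) (fun i _ => Nat.zero_le _) (Finset.mem_univ j)).trans hk
  rw [funext_iff, Sigma.forall]
  refine forall_congr' fun j => ?_
  rw [prefixNum_div _ (hkj j), ← hy, prefixNum_eq_iff, Fin.forall_iff]
  refine forall₂_congr fun r hr => ?_
  rw [outDigit_mul_pow_add hq C a (Finset.mem_range.mp hb)]
  change _ ↔ ∑ i : Fin m, C j r i * _ = y j r - outDigit C (q ^ m * a) j r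
  rw [eq_sub_iff_add_eq']

lemma abs_prod_sub_prod_le_sum {ι : Type*} (s : Finset ι) (f g : ι → ℝ)
    (hf : ∀ i ∈ s, 0 ≤ f i ∧ f i ≤ 1) (hg : ∀ i ∈ s, 0 ≤ g i ∧ g i ≤ 1) :
    |∏ i ∈ s, f i - ∏ i ∈ s, g i| ≤ ∑ i ∈ s, |f i - g i| := by
  classical
  induction s using Finset.induction_on with
  | empty => simp
  | insert a s ha ih =>
    rw [Finset.prod_insert ha, Finset.prod_insert ha, Finset.sum_insert ha]
    have hs := ih (fun i hi => hf i (Finset.mem_insert_of_mem hi))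
      fun i hi => hg i (Finset.mem_insert_of_mem hi)
    have hfa := hf a (Finset.mem_insert_self a s)
    have hG0 : 0 ≤ ∏ i ∈ s, g i :=
      Finset.prod_nonneg fun i hi => (hg i (Finset.mem_insert_of_mem hi)).1
    have hG1 : ∏ i ∈ s, g i ≤ 1 :=
      Finset.prod_le_one (fun i hi => (hg i (Finset.mem_insert_of_mem hi)).1)
        fun i hi => (hg i (Finset.mem_insert_of_mem hi)).2
    have h : f a * ∏ i ∈ s, f i - g a * ∏ i ∈ s, g i =
        (f a - g a) * ∏ i ∈ s, g i + f a * (∏ i ∈ s, f i - ∏ i ∈ s, g i) := by ring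
    rw [h]
    refine (abs_add_le _ _).trans (add_le_add ?_ ?_)
    · rw [abs_mul, abs_of_nonneg hG0]
      exact mul_le_of_le_one_right (abs_nonneg _) hG1
    · rw [abs_mul, abs_of_nonneg hfa.1]
      exact (mul_le_of_le_one_left (abs_nonneg _) hfa.2).trans hs

/-- The bound for the discrepancy of a block of `q ^ m` points with respect to anchored boxes. -/
noncomputable def blockBound {d q : ℕ} (C : Fin d → ℕ → ℕ → ZMod q) (m : ℕ) : ℝ :=
  2 * q ^ d * (∑ k ∈ lowShapes d m, (excess C m k : ℝ) + (m + 1) ^ (d - 1)) + d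

lemma abs_card_anchored_sub_le {d q : ℕ} (hd : 1 ≤ d) (hq : 2 ≤ q) (C : Fin d → ℕ → ℕ → ZMod q)
    (m a : ℕ) (w : Fin d → ℝ) (hw : ∀ j, 0 ≤ w j ∧ w j ≤ 1) :
    |(((Finset.range (q ^ m)).filter fun b => ∀ j, digitalSeq d C (q ^ m * a + b) j < w j).card : ℝ)
        - (q : ℝ) ^ m * ∏ j, w j| ≤ blockBound C m := by
  have : NeZero q := ⟨by omega⟩
  have hQ : (0 : ℝ) < (q : ℝ) ^ m := by
    have : (0 : ℝ) < q := by exact_mod_cast (by omega : 0 < q)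
    positivity
  let T : ℕ → Fin d → ℕ := fun b j => prefixNum (outDigit C (q ^ m * a + b) j) m
  let B : Fin d → ℕ := fun j => ⌈(q : ℝ) ^ m * w j⌉₊
  have hB1 : ∀ j, (q : ℝ) ^ m * w j ≤ B j := fun j => Nat.le_ceil _
  have hB2 : ∀ j, (B j : ℝ) < q ^ m * w j + 1 := fun j =>
    Nat.ceil_lt_add_one (mul_nonneg hQ.le (hw j).1)
  have hB : ∀ j, B j ≤ q ^ m := fun j => by
    refine Nat.ceil_le.mpr ?_
    push_cast
    exact mul_le_of_le_one_right hQ.le (hw j).2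
  have hx := fun b j => tsum_digits_mem_Icc hq (outDigit C (q ^ m * a + b) j) m
  simp only [← digitalSeq_eq] at hx
  have hmain : ∀ B' : Fin d → ℕ, (∀ j, B' j ≤ q ^ m) → _ := fun B' hB' =>
    abs_card_sub_volume_le hd hq B' hB' (Finset.range (q ^ m)) T
      (fun b _ j => prefixNum_lt _ m) (fun k => (excess C m k : ℝ)) (fun k => by positivity)
      fun k hk c hc => abs_card_block_cell_sub_le hq C m a k hk c hc
  have hvol : ∀ B' : Fin d → ℕ, (∀ j, B' j ≤ q ^ m) → (∀ j, |(B' j : ℝ) - q ^ m * w j| ≤ 1) →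
      |(q : ℝ) ^ m * ∏ j, ((B' j : ℝ) / q ^ m) - q ^ m * ∏ j, w j| ≤ d := by
    intro B' hB' h
    rw [← mul_sub, abs_mul, abs_of_pos hQ]
    calc (q : ℝ) ^ m * |∏ j, ((B' j : ℝ) / q ^ m) - ∏ j, w j|
        ≤ q ^ m * ∑ j, |(B' j : ℝ) / q ^ m - w j| := by
          refine mul_le_mul_of_nonneg_left ?_ hQ.le
          refine abs_prod_sub_prod_le_sum _ _ _ (fun j _ => ⟨by positivity, ?_⟩) fun j _ => hw j
          rw [div_le_one hQ]
          exact_mod_cast hB' j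
      _ = ∑ j, |(B' j : ℝ) - q ^ m * w j| := by
          rw [Finset.mul_sum]
          refine Finset.sum_congr rfl fun j _ => ?_
          rw [← abs_of_pos hQ, ← abs_mul, abs_of_pos hQ]
          congr 1
          field_simp
      _ ≤ ∑ j : Fin d, 1 := Finset.sum_le_sum fun j _ => h j
      _ = d := by simp
  have hupper : ((Finset.range (q ^ m)).filter
      fun b => ∀ j, digitalSeq d C (q ^ m * a + b) j < w j).card ≤
      ((Finset.range (q ^ m)).filter fun b => ∀ j, T b j < B j).card := by
    refine Finset.card_le_card (Finset.monotone_filter_right _ fun b _ h j => ?_)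
    refine Nat.lt_ceil.mpr ((hx b j).1.trans_lt ?_)
    exact mul_lt_mul_of_pos_left (h j) hQ
  have hlower : ((Finset.range (q ^ m)).filter fun b => ∀ j, T b j < B j - 1).card ≤
      ((Finset.range (q ^ m)).filter
        fun b => ∀ j, digitalSeq d C (q ^ m * a + b) j < w j).card := by
    refine Finset.card_le_card (Finset.monotone_filter_right _ fun b _ h j => ?_)
    have h1 : T b j + 1 < B j := by have := h j; omega
    have h2 := Nat.lt_ceil.mp h1
    push_cast at h2
    exact lt_of_mul_lt_mul_left ((hx b j).2.trans_lt h2) hQ.le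
  have hupper' : (_ : ℝ) ≤ _ := Nat.cast_le.mpr hupper
  have hlower' : (_ : ℝ) ≤ _ := Nat.cast_le.mpr hlower
  have m1 := abs_le.mp (hmain B hB)
  have m2 := abs_le.mp (hmain (fun j => B j - 1) fun j => (Nat.sub_le _ _).trans (hB j))
  have v1 := abs_le.mp (hvol B hB fun j => by
    rw [abs_le]; constructor <;> linarith [hB1 j, hB2 j])
  have v2 := abs_le.mp (hvol (fun j => B j - 1) (fun j => (Nat.sub_le _ _).trans (hB j))
    fun j => by
      have h1 := hB1 j
      have h2 := hB2 j
      have h3 : 0 ≤ (q : ℝ) ^ m * w j := mul_nonneg hQ.le (hw j).1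
      rcases Nat.eq_zero_or_pos (B j) with h0 | h0
      · rw [h0] at h1 h2 ⊢
        rw [abs_le]
        constructor <;> push_cast at h1 h2 ⊢ <;> linarith
      · rw [Nat.cast_sub h0, abs_le]
        push_cast
        constructor <;> linarith)
  rw [blockBound, abs_le]
  constructor <;> linarith

lemma prod_sub_eq_sum_piecewise {d : ℕ} (f g : Fin d → ℝ) :
    ∏ j, (f j - g j) = ∑ t : Finset (Fin d), (-1) ^ t.card * ∏ j, t.piecewise g f j := by
  rw [Finset.prod_sub, Finset.powerset_univ]
  refine Finset.sum_congr rfl fun t _ => ?_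
  rw [Finset.prod_piecewise, Finset.univ_inter]
  ring

lemma abs_card_box_sub_le {d q : ℕ} (hd : 1 ≤ d) (hq : 2 ≤ q) (C : Fin d → ℕ → ℕ → ZMod q)
    (m a : ℕ) (u v : Fin d → ℝ) (huv : ∀ j, 0 ≤ u j ∧ u j ≤ v j ∧ v j ≤ 1) :
    |∑ b ∈ Finset.range (q ^ m), ((if ∀ j, u j ≤ digitalSeq d C (q ^ m * a + b) j ∧
        digitalSeq d C (q ^ m * a + b) j < v j then (1 : ℝ) else 0) - ∏ j, (v j - u j))| ≤
      2 ^ d * blockBound C m := by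
  set x := digitalSeq d C
  have hprod : ∀ (p : Fin d → Prop) [DecidablePred p],
      (if ∀ j, p j then (1 : ℝ) else 0) = ∏ j, if p j then 1 else 0 := by
    intro p _
    rw [Finset.prod_ite_zero]
    simp
  have hind : ∀ n, (if ∀ j, u j ≤ x n j ∧ x n j < v j then (1 : ℝ) else 0) =
      ∑ t : Finset (Fin d), (-1) ^ t.card *
        if ∀ j, x n j < t.piecewise u v j then (1 : ℝ) else 0 := by
    intro n
    have h1 : (if ∀ j, u j ≤ x n j ∧ x n j < v j then (1 : ℝ) else 0) =
        ∏ j, ((if x n j < v j then (1 : ℝ) else 0) - if x n j < u j then 1 else 0) := by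
      rw [hprod]
      refine Finset.prod_congr rfl fun j _ => ?_
      have := (huv j).2.1
      by_cases h : x n j < u j
      · simp [h, h.trans_le this, not_le.mpr h]
      · simp [h, not_lt.mp h]
    rw [h1, prod_sub_eq_sum_piecewise]
    refine Finset.sum_congr rfl fun t _ => ?_
    rw [hprod]
    congr 1
    refine Finset.prod_congr rfl fun j _ => ?_
    by_cases h : j ∈ t <;> simp [h]
  have hq' : ∑ b ∈ Finset.range (q ^ m), ((if ∀ j, u j ≤ x (q ^ m * a + b) j ∧
        x (q ^ m * a + b) j < v j then (1 : ℝ) else 0) - ∏ j, (v j - u j)) =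
      ∑ t : Finset (Fin d), (-1) ^ t.card * ((((Finset.range (q ^ m)).filter
        fun b => ∀ j, x (q ^ m * a + b) j < t.piecewise u v j).card : ℝ)
          - (q : ℝ) ^ m * ∏ j, t.piecewise u v j) := by
    simp only [hind, prod_sub_eq_sum_piecewise, ← Finset.sum_sub_distrib, ← mul_sub]
    rw [Finset.sum_comm]
    refine Finset.sum_congr rfl fun t _ => ?_
    rw [← Finset.mul_sum, Finset.sum_sub_distrib, Finset.card_filter]
    simp
  rw [hq']
  refine (Finset.abs_sum_le_sum_abs _ _).trans ?_
  refine (Finset.sum_le_card_nsmul _ _ (blockBound C m) fun t _ => ?_).trans (le_of_eq ?_)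
  · rw [abs_mul, abs_pow, abs_neg, abs_one, one_pow, one_mul]
    refine abs_card_anchored_sub_le hd hq C m a _ fun j => ?_
    have := huv j
    by_cases h : j ∈ t
    · simp only [h, Finset.piecewise_eq_of_mem]
      exact ⟨this.1, this.2.1.trans this.2.2⟩
    · simp only [h, not_false_eq_true, Finset.piecewise_eq_of_notMem]
      exact ⟨this.1.trans this.2.1, this.2.2⟩
  · rw [nsmul_eq_mul]
    simp

lemma abs_sum_range_le_of_blocks {q : ℕ} (hq : 2 ≤ q) (h : ℕ → ℝ) (E : ℕ → ℝ)
    (hE : ∀ m a, |∑ b ∈ Finset.range (q ^ m), h (q ^ m * a + b)| ≤ E m) {N M : ℕ}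
    (hN : N < q ^ M) :
    |∑ n ∈ Finset.range N, h n| ≤ q * ∑ m ∈ Finset.range M, E m := by
  let D : ℕ → ℝ := fun n => ∑ i ∈ Finset.range n, h i
  have hE0 : ∀ m, 0 ≤ E m := fun m => (abs_nonneg _).trans (hE m 0)
  have hstep : ∀ m a c, |D (q ^ m * (a + c)) - D (q ^ m * a)| ≤ c * E m := by
    intro m a c
    induction c with
    | zero => simp
    | succ c ih =>
      have h1 : D (q ^ m * (a + (c + 1))) =
          D (q ^ m * (a + c)) + ∑ b ∈ Finset.range (q ^ m), h (q ^ m * (a + c) + b) := by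
        simp only [D]
        rw [← Finset.sum_range_add]
        congr 2
      rw [h1, add_sub_right_comm]
      refine (abs_add_le _ _).trans ?_
      push_cast
      rw [add_mul, one_mul]
      exact add_le_add ih (hE m _)
  have htel := Finset.sum_range_sub' (fun m => D (q ^ m * (N / q ^ m))) M
  simp only [pow_zero, Nat.div_one, one_mul, Nat.div_eq_of_lt hN, mul_zero] at htel
  have hD0 : D 0 = 0 := by simp [D]
  rw [hD0, sub_zero] at htel
  change |D N| ≤ _
  rw [← htel, Finset.mul_sum]
  refine (Finset.abs_sum_le_sum_abs _ _).trans (Finset.sum_le_sum fun m _ => ?_)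
  have h2 : q ^ m * (N / q ^ m) = q ^ m * (q * (N / q ^ (m + 1)) + N / q ^ m % q) := by
    rw [pow_succ, ← Nat.div_div_eq_div_mul, Nat.div_add_mod]
  rw [h2, pow_succ, mul_assoc]
  refine (hstep m _ _).trans (mul_le_mul_of_nonneg_right ?_ (hE0 m))
  exact_mod_cast (Nat.mod_lt _ (by omega)).le

lemma disc_digitalSeq_le {d q : ℕ} (hd : 1 ≤ d) (hq : 2 ≤ q) (C : Fin d → ℕ → ℕ → ZMod q)
    {N M : ℕ} (hN0 : 0 < N) (hN : N < q ^ M) :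
    disc (digitalSeq d C) N ≤ q * 2 ^ d * (∑ m ∈ Finset.range M, blockBound C m) / N := by
  have hB0 : ∀ m, 0 ≤ blockBound C m := fun m => by unfold blockBound; positivity
  refine Real.sSup_le ?_ (div_nonneg (mul_nonneg (by positivity)
    (Finset.sum_nonneg fun m _ => hB0 m)) (by positivity))
  rintro r ⟨u, v, huv, rfl⟩
  have hN' : (0 : ℝ) < N := by exact_mod_cast hN0
  have hcard : (Nat.card {n : ℕ // n < N ∧ ∀ i, u i ≤ digitalSeq d C n i ∧
      digitalSeq d C n i < v i} : ℝ) = ∑ n ∈ Finset.range N,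
        if ∀ j, u j ≤ digitalSeq d C n j ∧ digitalSeq d C n j < v j then (1 : ℝ) else 0 := by
    rw [Finset.sum_boole, Nat.subtype_card]
    simp
  have h := abs_sum_range_le_of_blocks hq
    (fun n => (if ∀ j, u j ≤ digitalSeq d C n j ∧ digitalSeq d C n j < v j then (1 : ℝ) else 0)
      - ∏ j, (v j - u j)) (fun m => 2 ^ d * blockBound C m)
    (fun m a => abs_card_box_sub_le hd hq C m a u v huv) hN
  rw [Finset.sum_sub_distrib, ← hcard, ← Finset.mul_sum] at h
  simp only [Finset.sum_const, Finset.card_range, nsmul_eq_mul] at h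
  rw [le_div_iff₀ hN', ← abs_of_pos hN', ← abs_mul, abs_of_pos hN', sub_mul,
    div_mul_cancel₀ _ hN'.ne', mul_assoc, mul_comm _ (N : ℝ)]
  exact h

/-- One plus the number of binary digits of `m + 1` after the leading one. -/
def logSize (m : ℕ) : ℕ := Nat.log 2 (m + 1) + 1

lemma lt_two_pow_logSize (m : ℕ) : m + 1 < 2 ^ logSize m :=
  Nat.lt_pow_succ_log_self one_lt_two (m + 1)

lemma one_le_logSize (m : ℕ) : (1 : ℝ) ≤ logSize m := by
  exact_mod_cast Nat.le_add_left 1 _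

lemma logSize_mono : Monotone logSize := fun _ _ h =>
  Nat.add_le_add_right (Nat.log_mono_right (Nat.add_le_add_right h 1)) 1

/-- The growth rate of the sums of discrepancy bounds of blocks of `q ^ m` points. -/
noncomputable def growth (d : ℕ) (ε : ℝ) (m : ℕ) : ℝ :=
  ((m : ℝ) + 1) ^ d * (logSize m : ℝ) ^ ((2 : ℝ) + ε)

lemma growth_pos (d : ℕ) (ε : ℝ) (m : ℕ) : 0 < growth d ε m := by
  have := one_le_logSize m
  unfold growth
  positivity

lemma growth_mono (d : ℕ) {ε : ℝ} (hε : 0 < ε) : Monotone (growth d ε) := by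
  intro m n h
  have h1 : (m : ℝ) ≤ n := by exact_mod_cast h
  have h2 : (logSize m : ℝ) ≤ logSize n := by exact_mod_cast logSize_mono h
  unfold growth
  gcongr

lemma pow_le_growth (d : ℕ) {ε : ℝ} (hε : 0 < ε) (m : ℕ) : ((m : ℝ) + 1) ^ d ≤ growth d ε m :=
  le_mul_of_one_le_right (by positivity) (Real.one_le_rpow (one_le_logSize m) (by linarith))

lemma summable_one_div_mul_logSize_rpow {ε : ℝ} (hε : 0 < ε) :
    Summable fun m : ℕ => 1 / (((m : ℝ) + 1) * (logSize m : ℝ) ^ (1 + ε)) := by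
  let g : ℕ → ℝ := fun n => 1 / ((n : ℝ) * ((Nat.log 2 n + 1 : ℕ) : ℝ) ^ (1 + ε))
  have hg : Summable g := by
    rw [← summable_condensed_iff_of_nonneg (fun n => by positivity)]
    · have h := (summable_nat_add_iff 1).mpr
        (Real.summable_one_div_nat_rpow.mpr (by linarith : 1 < 1 + ε))
      refine h.congr fun k => ?_
      have : (0 : ℝ) < ((k + 1 : ℕ) : ℝ) ^ (1 + ε) := by positivity
      simp only [g, Nat.log_pow one_lt_two]
      push_cast at this ⊢
      field_simp
    · intro m n hm hmn
      have h1 : (m : ℝ) ≤ n := by exact_mod_cast hmn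
      have h2 : ((Nat.log 2 m + 1 : ℕ) : ℝ) ≤ (Nat.log 2 n + 1 : ℕ) := by
        exact_mod_cast Nat.add_le_add_right (Nat.log_mono_right hmn) 1
      have h3 : (0 : ℝ) < m := by exact_mod_cast hm
      simp only [g]
      gcongr
  refine ((summable_nat_add_iff 1).mpr hg).congr fun m => ?_
  simp only [g, logSize]
  push_cast
  rfl

lemma summable_mul_pow_div_growth {d : ℕ} (hd : 1 ≤ d) {ε : ℝ} (hε : 0 < ε) :
    Summable fun m : ℕ =>
      (((d + 2) * logSize m + 1) * (m + 1) ^ (d - 1) : ℕ) / growth d ε m := by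
  refine Summable.of_nonneg_of_le
    (fun m => div_nonneg (Nat.cast_nonneg _) (growth_pos d ε m).le) (fun m => ?_)
    ((summable_one_div_mul_logSize_rpow hε).mul_left (d + 3 : ℝ))
  have h1 := one_le_logSize m
  have h0 : (0 : ℝ) < logSize m := by linarith
  obtain ⟨e, rfl⟩ := Nat.exists_eq_add_of_le' hd
  rw [growth, show (2 : ℝ) + ε = 1 + (1 + ε) by ring, Real.rpow_add h0, Real.rpow_one,
    div_le_iff₀ (by positivity), Nat.add_sub_cancel]
  have h2 : (0 : ℝ) < (logSize m : ℝ) ^ (1 + ε) := by positivity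
  have h3 : ((e + 1 : ℕ) + 3 : ℝ) * (1 / (((m : ℝ) + 1) * (logSize m : ℝ) ^ (1 + ε))) *
      (((m : ℝ) + 1) ^ (e + 1) * (logSize m * (logSize m : ℝ) ^ (1 + ε))) =
      (((e + 1 : ℕ) + 3 : ℝ) * logSize m) * (m + 1) ^ e := by
    field_simp
    ring
  rw [h3]
  push_cast
  gcongr
  nlinarith

lemma IsUniformLaw.ae_eventually_excess_eq_zero {d q : ℕ} [Fact q.Prime]
    {μ : Measure (Fin d → ℕ → ℕ → ZMod q)} [IsProbabilityMeasure μ] (hμ : IsUniformLaw μ) :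
    ∀ᵐ C ∂μ, ∀ᶠ m in Filter.atTop, ∀ k : Fin d → ℕ,
      ∑ j, k j + (d + 2) * logSize m < m → excess C m k = 0 := by
  have hq : 2 ≤ q := (Fact.out : q.Prime).two_le
  let K : ℕ → Finset (Fin d → ℕ) := fun m =>
    (lowShapes d m).filter fun k => ∑ j, k j + (d + 2) * logSize m < m
  let B : ℕ → Set (Fin d → ℕ → ℕ → ZMod q) := fun m => ⋃ k ∈ K m, {C | excess C m k ≠ 0}
  have hB : ∀ m, μ (B m) ≤ ENNReal.ofReal (1 / ((m + 1 : ℕ) : ℝ) ^ 2) := by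
    intro m
    have hcard : (K m).card ≤ (m + 1) ^ d := by
      refine (Finset.card_le_card ((Finset.filter_subset _ _).trans
        (Finset.filter_subset _ _))).trans ?_
      simp
    have hterm : ∀ k ∈ K m, μ {C | excess C m k ≠ 0} ≤
        (((m + 1) ^ (d + 2) : ℕ) : ENNReal)⁻¹ := by
      intro k hk
      obtain ⟨hk, hlt⟩ := Finset.mem_filter.mp hk
      refine (hμ.measure_excess_ne_zero_le (mem_lowShapes.mp hk)).trans (ENNReal.inv_le_inv.mpr ?_)
      have : (m + 1) ^ (d + 2) ≤ q ^ (m - ∑ j, k j) := by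
        calc (m + 1) ^ (d + 2) ≤ (2 ^ logSize m) ^ (d + 2) :=
              Nat.pow_le_pow_left (lt_two_pow_logSize m).le _
          _ = 2 ^ ((d + 2) * logSize m) := by rw [← pow_mul, mul_comm]
          _ ≤ 2 ^ (m - ∑ j, k j) := Nat.pow_le_pow_right two_pos (by omega)
          _ ≤ q ^ (m - ∑ j, k j) := Nat.pow_le_pow_left hq _
      exact_mod_cast this
    refine (measure_biUnion_finset_le _ _).trans ((Finset.sum_le_card_nsmul _ _ _ hterm).trans ?_)
    rw [nsmul_eq_mul]
    have hm : (0 : ℝ) < (((m + 1) ^ (d + 2) : ℕ) : ℝ) := by positivity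
    rw [← ENNReal.ofReal_natCast ((m + 1) ^ (d + 2)), ← ENNReal.ofReal_inv_of_pos hm,
      ← ENNReal.ofReal_natCast, ← ENNReal.ofReal_mul (Nat.cast_nonneg _)]
    refine ENNReal.ofReal_le_ofReal ?_
    rw [← div_eq_mul_inv, div_le_div_iff₀ hm (by positivity), one_mul]
    have := Nat.mul_le_mul_right ((m + 1) ^ 2) hcard
    rw [← pow_add] at this
    exact_mod_cast this
  have hsum : ∑' m, μ (B m) ≠ ⊤ := by
    have h := (summable_nat_add_iff 1).mpr
      (Real.summable_one_div_nat_pow.mpr (by norm_num : 1 < 2))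
    exact ((ENNReal.tsum_le_tsum hB).trans_lt h.tsum_ofReal_lt_top).ne
  filter_upwards [ae_eventually_notMem hsum] with C hC
  filter_upwards [hC] with m hm k hk
  by_contra hne
  refine hm (Set.mem_biUnion (x := k) ?_ hne)
  exact Finset.mem_filter.mpr ⟨mem_lowShapes.mpr (by omega), hk⟩

lemma IsUniformLaw.ae_summable_near_excess {d q : ℕ} (hd : 1 ≤ d) [Fact q.Prime]
    {μ : Measure (Fin d → ℕ → ℕ → ZMod q)} [IsProbabilityMeasure μ] (hμ : IsUniformLaw μ)
    {ε : ℝ} (hε : 0 < ε) :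
    ∀ᵐ C ∂μ, Summable fun m =>
      (∑ k ∈ (lowShapes d m).filter fun k => m ≤ ∑ j, k j + (d + 2) * logSize m,
        (excess C m k : ℝ)) / growth d ε m := by
  let W : ℕ → (Fin d → ℕ → ℕ → ZMod q) → ENNReal := fun m C =>
    (∑ k ∈ (lowShapes d m).filter fun k => m ≤ ∑ j, k j + (d + 2) * logSize m,
      (excess C m k : ENNReal)) * ENNReal.ofReal (growth d ε m)⁻¹
  have hexc : ∀ m k, Measurable fun C : Fin d → ℕ → ℕ → ZMod q => (excess C m k : ENNReal) :=
    fun m k => (measurable_from_top (f := fun n : ℕ => (n : ENNReal))).comp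
      (hμ.measurable_excess m k)
  have hmeas : ∀ m, Measurable (W m) := fun m =>
    (Finset.measurable_sum _ fun k _ => hexc m k).mul_const _
  have hint : ∀ m, ∫⁻ C, W m C ∂μ ≤
      ENNReal.ofReal ((((d + 2) * logSize m + 1) * (m + 1) ^ (d - 1) : ℕ) / growth d ε m) := by
    intro m
    simp only [W]
    rw [lintegral_mul_const _ (Finset.measurable_sum _ fun k _ => hexc m k),
      lintegral_finsetSum _ fun k _ => hexc m k, div_eq_mul_inv,
      ENNReal.ofReal_mul (Nat.cast_nonneg _), ENNReal.ofReal_natCast]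
    gcongr
    refine (Finset.sum_le_card_nsmul _ _ 1 fun k hk => ?_).trans ?_
    · exact hμ.lintegral_excess_le (mem_lowShapes.mp (Finset.mem_filter.mp hk).1)
    · rw [nsmul_one]
      exact_mod_cast card_filter_lowShapes_le hd m _
  have hfin : ∫⁻ C, ∑' m, W m C ∂μ ≠ ⊤ := by
    rw [lintegral_tsum fun m => (hmeas m).aemeasurable]
    exact ((ENNReal.tsum_le_tsum hint).trans_lt
      (summable_mul_pow_div_growth hd hε).tsum_ofReal_lt_top).ne
  filter_upwards [ae_lt_top (Measurable.tsum hmeas) hfin] with C hC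
  refine (ENNReal.summable_toReal hC.ne).congr fun m => ?_
  simp only [W]
  rw [ENNReal.toReal_mul, ENNReal.toReal_ofReal (inv_nonneg.mpr (growth_pos d ε m).le),
    ENNReal.toReal_sum fun k _ => ENNReal.natCast_ne_top _, div_eq_mul_inv]
  simp

lemma IsUniformLaw.ae_summable_excess {d q : ℕ} (hd : 1 ≤ d) [Fact q.Prime]
    {μ : Measure (Fin d → ℕ → ℕ → ZMod q)} [IsProbabilityMeasure μ] (hμ : IsUniformLaw μ)
    {ε : ℝ} (hε : 0 < ε) :
    ∀ᵐ C ∂μ, Summable fun m => (∑ k ∈ lowShapes d m, (excess C m k : ℝ)) / growth d ε m := by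
  filter_upwards [hμ.ae_summable_near_excess hd hε, hμ.ae_eventually_excess_eq_zero] with C hC hC'
  refine hC.congr_atTop ?_
  filter_upwards [hC'] with m hm
  congr 1
  refine Finset.sum_filter_of_ne fun k _ hne => ?_
  by_contra hlt
  exact hne (by rw [hm k (by omega), Nat.cast_zero])

lemma sum_range_succ_le_tsum_mul {U a : ℕ → ℝ} (hU : ∀ m, 0 ≤ U m) (ha : ∀ m, 0 < a m)
    (ha' : Monotone a) (h : Summable fun m => U m / a m) (M : ℕ) :
    ∑ m ∈ Finset.range (M + 1), U m ≤ (∑' m, U m / a m) * a M := by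
  calc ∑ m ∈ Finset.range (M + 1), U m
      ≤ ∑ m ∈ Finset.range (M + 1), U m / a m * a M := by
        refine Finset.sum_le_sum fun m hm => ?_
        rw [div_mul_eq_mul_div, le_div_iff₀ (ha m)]
        exact mul_le_mul_of_nonneg_left
          (ha' (Nat.lt_succ_iff.mp (Finset.mem_range.mp hm))) (hU m)
    _ ≤ (∑' m, U m / a m) * a M := by
        rw [← Finset.sum_mul]
        exact mul_le_mul_of_nonneg_right
          (h.sum_le_tsum _ fun m _ => div_nonneg (hU m) (ha m).le) (ha M).le

lemma sum_blockBound_le {d q : ℕ} (hd : 1 ≤ d) (C : Fin d → ℕ → ℕ → ZMod q) {ε : ℝ} (hε : 0 < ε)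
    (h : Summable fun m => (∑ k ∈ lowShapes d m, (excess C m k : ℝ)) / growth d ε m) (M : ℕ) :
    ∑ m ∈ Finset.range (M + 1), blockBound C m ≤
      (2 * q ^ d * ((∑' m, (∑ k ∈ lowShapes d m, (excess C m k : ℝ)) / growth d ε m) + 1) + d) *
        growth d ε M := by
  have h1 := sum_range_succ_le_tsum_mul
    (fun m => Finset.sum_nonneg fun k _ => Nat.cast_nonneg (excess C m k))
    (growth_pos d ε) (growth_mono d hε) h M
  have hg := pow_le_growth d hε M
  have hM : (1 : ℝ) ≤ (M : ℝ) + 1 := by simp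
  have h2 : ∑ m ∈ Finset.range (M + 1), ((m : ℝ) + 1) ^ (d - 1) ≤ growth d ε M := by
    refine (Finset.sum_le_card_nsmul _ _ (((M : ℝ) + 1) ^ (d - 1)) fun m hm => ?_).trans ?_
    · have : (m : ℝ) ≤ M := by exact_mod_cast Nat.lt_succ_iff.mp (Finset.mem_range.mp hm)
      gcongr
    · rw [Finset.card_range, nsmul_eq_mul, Nat.cast_succ, mul_pow_sub_one (by omega)]
      exact hg
  have h3 : (M : ℝ) + 1 ≤ growth d ε M := (le_self_pow₀ hM (by omega)).trans hg
  simp only [blockBound]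
  rw [Finset.sum_add_distrib, ← Finset.mul_sum, Finset.sum_add_distrib, Finset.sum_const,
    Finset.card_range, nsmul_eq_mul, Nat.cast_succ, mul_comm _ (d : ℝ)]
  refine (add_le_add (mul_le_mul_of_nonneg_left (add_le_add h1 h2) (by positivity))
    (mul_le_mul_of_nonneg_left h3 (Nat.cast_nonneg d))).trans_eq ?_
  ring

lemma exists_growth_log_le (d : ℕ) {q : ℕ} (hq : 2 ≤ q) {ε : ℝ} (hε : 0 < ε) :
    ∃ c > 0, ∀ N : ℕ, 3 ≤ N → growth d ε (Nat.log q N) ≤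
      c * (Real.log N ^ d * Real.log (Real.log N) ^ ((2 : ℝ) + ε)) := by
  have hlog3 : 1 < Real.log 3 := by
    rw [Real.lt_log_iff_exp_lt (by norm_num)]
    exact Real.exp_one_lt_three
  have hll3 : 0 < Real.log (Real.log 3) := Real.log_pos hlog3
  have hlog2 : 1 / 2 < Real.log 2 := by linarith [Real.log_two_gt_d9]
  have hnatlog : ∀ {b n : ℕ}, 2 ≤ b → 1 ≤ n → (Nat.log b n : ℝ) ≤ 2 * Real.log n := by
    intro b n hb hn
    have hn0 : 0 ≤ Real.log n := Real.log_natCast_nonneg n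
    have hb' : Real.log 2 ≤ Real.log b := Real.log_le_log two_pos (by exact_mod_cast hb)
    refine (Real.natLog_le_logb n b).trans ?_
    rw [Real.logb, div_le_iff₀ (by linarith)]
    nlinarith
  set κ : ℝ := 2 + (2 * Real.log 3 + 1) / Real.log (Real.log 3) with hκ
  have hκ0 : 0 < κ := by positivity
  refine ⟨3 ^ d * κ ^ ((2 : ℝ) + ε), by positivity, fun N hN => ?_⟩
  have hN' : (3 : ℝ) ≤ N := by exact_mod_cast hN
  have hL : Real.log 3 ≤ Real.log N := Real.log_le_log (by norm_num) hN'
  have hLL : Real.log (Real.log 3) ≤ Real.log (Real.log N) :=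
    Real.log_le_log (by linarith) hL
  have hm : (Nat.log q N : ℝ) + 1 ≤ 3 * Real.log N := by
    have := hnatlog hq (n := N) (by omega)
    linarith
  have hsize : (logSize (Nat.log q N) : ℝ) ≤ κ * Real.log (Real.log N) := by
    have h1 := hnatlog le_rfl (n := Nat.log q N + 1) (by omega)
    have h2 : Real.log ((Nat.log q N + 1 : ℕ) : ℝ) ≤ Real.log 3 + Real.log (Real.log N) := by
      rw [← Real.log_mul (by norm_num) (by linarith)]
      refine Real.log_le_log (by positivity) ?_
      push_cast
      exact hm
    have h3 : 2 * Real.log 3 + 1 ≤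
        (2 * Real.log 3 + 1) / Real.log (Real.log 3) * Real.log (Real.log N) := by
      rw [div_mul_eq_mul_div, le_div_iff₀ hll3]
      gcongr
    rw [logSize, hκ, add_mul]
    push_cast at h1 h2 ⊢
    linarith
  have hLL0 : 0 ≤ Real.log (Real.log N) := hll3.le.trans hLL
  calc growth d ε (Nat.log q N)
      ≤ (3 * Real.log N) ^ d * (κ * Real.log (Real.log N)) ^ ((2 : ℝ) + ε) := by
        unfold growth
        gcongr
    _ = _ := by
        rw [mul_pow, Real.mul_rpow hκ0.le hLL0]
        ring

theorem stmt2 (d : ℕ) (hd : 1 ≤ d) (q : ℕ) (hq : q.Prime) (ε : ℝ) (hε : 0 < ε)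
    (μ : Measure (Fin d → ℕ → ℕ → ZMod q)) [IsProbabilityMeasure μ]
    (hμ : ∀ (s : Finset (Fin d × ℕ × ℕ)) (v : Fin d × ℕ × ℕ → ZMod q),
      μ {C | ∀ p ∈ s, C p.1 p.2.1 p.2.2 = v p} = ((q : ENNReal))⁻¹ ^ s.card) :
    ∀ᵐ C ∂μ, ∃ c > 0, ∀ N : ℕ, 3 ≤ N →
      disc (digitalSeq d C) N
        ≤ c * Real.log N ^ d * Real.log (Real.log N) ^ ((2 : ℝ) + ε) / N := by
  have : Fact q.Prime := ⟨hq⟩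
  have hlaw : IsUniformLaw μ := hμ
  obtain ⟨c, hc, hgrowth⟩ := exists_growth_log_le d hq.two_le hε
  filter_upwards [hlaw.ae_summable_excess hd hε] with C hC
  have hS : 0 ≤ ∑' m, (∑ k ∈ lowShapes d m, (excess C m k : ℝ)) / growth d ε m :=
    tsum_nonneg fun m => div_nonneg (Finset.sum_nonneg fun k _ => Nat.cast_nonneg _)
      (growth_pos d ε m).le
  have hsum := sum_blockBound_le hd C hε hC
  set S := ∑' m, (∑ k ∈ lowShapes d m, (excess C m k : ℝ)) / growth d ε m
  have hq0 : (0 : ℝ) < q := by exact_mod_cast hq.pos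
  refine ⟨q * 2 ^ d * ((2 * q ^ d * (S + 1) + d) * c), by positivity, fun N hN => ?_⟩
  refine (disc_digitalSeq_le hd hq.two_le C (by omega)
    (Nat.lt_pow_succ_log_self hq.one_lt N)).trans ?_
  rw [mul_assoc _ (Real.log N ^ d), mul_assoc ((q : ℝ) * 2 ^ d), mul_assoc _ c]
  gcongr
  refine (hsum _).trans ?_
  gcongr
  exact hgrowth N hN
end
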